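/- Fix integers $d,q\ge 1$. Let $f:\mathbb R^d\to\mathbb R$ be four times continuously differentiable with a unique global minimizer $x^\star$ that is well separated, i.e. $\inf_{\|x-x^\star\|\ge\delta} f(x)>f(x^\star)$ for every $\delta>0$. Assume that the Hessian $H:=H_f(x^\star)$ is positive definite and that $\int_{\mathbb R^d} e^{-f(x)}\,dx<\infty$. For $\alpha>0$ let $Z_\alpha:=\int e^{-\alpha f}$, let $\pi_\alpha$ be the probability measure with density $e^{-\alpha f}/Z_\alpha$, write $\pi_\alpha(\varphi):=\int\varphi\,d\pi_\alpha$, and put $m_\alpha:=\sqrt{\det H}\,(\alpha/(2\pi))^{d/2}$. For a twice continuously differentiable $\psi:\mathbb R^d\to\mathbb R$ define $$C_{f,\psi}:=\Bigl|\operatorname{Tr}\bigl(H^{-1}H_\psi(x^\star)\bigr)-\bigl\langle H^{-1}\nabla\psi(x^\star),\,\mathrm{PTr}(D^3f(x^\star))\bigr\rangle\Bigr|,\qquad \mathrm{PTr}(D^3f(x^\star))_i:=\sum_{k,l=1}^d (H^{-1})_{kl}\,\partial_i\partial_k\partial_l f(x^\star).$$ Let $\varphi:\mathbb R^d\to\mathbb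 R^q$ be measurable with $\int e^{-(f(y)-f(x^\star))}\|\varphi(y)\|^2\,dy<\infty$, and put $\bar\varphi:=\varphi-\varphi(x^\star)$. Let $g_0:\mathbb R^d\to(0,\infty)$ be such that $e^{-(f(y)-f(x^\star))}\le c_0\,g_0(y)$ for all $y$, for some constant $c_0>0$; such that $\|\varphi\|^2/g_0$, $\|\bar\varphi\|^2/g_0$ and $1/g_0$ are twice continuously differentiable; and such that $C_{f,\|\varphi\|^2/g_0}$, $C_{f,\|\bar\varphi\|^2/g_0}$ and $C_{f,1/g_0}$ are positive. Let $\mathcal Q$ be a family of probability densities on $\mathbb R^d$ with $g_0\le p$ pointwise and $\int\|\varphi\|^4p\le M$ for all $p\in\mathcal Q$, where $M<\infty$. Let $(\mathcal F_i)_{i\ge 0}$ be a filtration on a probability space; let $X^1$ be $\mathcal F_1$-measurable with (deterministic) density $q_0\in\mathcal Q$, and for each $i\ge1$ let $X^{i+1}$ be $\mathcal F_{i+1}$-measurable and such that its conditional distribution given $\mathcal F_i$ has an $\mathcal F_i$-measurable random density $q_i$ that belongs almost surely to $\mathcal Q$. Put $w^i:=e^{-\alpha f(X^i)}/q_{i-1}(X^i)$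 and $$\pi^{(A)}_{n,\alpha}(\varphi):=\frac{\sum_{i=1}^n w^i\varphi(X^i)}{\sum_{i=1}^n w^i}.$$ Then there exist a constant $\tilde\alpha>1$ depending only on $f$ and $\varphi$, a constant $c>0$ depending only on $f,g_0,\varphi$, and a constant $C>0$ depending only on $f,g_0,\varphi$ and $M$, such that for every $\alpha>\tilde\alpha$ and every integer $n\ge1$ satisfying $$n\ \ge\ c\,\alpha^{d/2}\log\!\Bigl(n\,\alpha^{-d/2+1}\bigl(\sqrt n+\alpha^{d/4}\bigr)\alpha\Bigr),$$ the random variable $\|\pi^{(A)}_{n,\alpha}(\varphi)-\pi_\alpha(\varphi)\|^2$ is integrable and $$\mathbb E\bigl\|\pi^{(A)}_{n,\alpha}(\varphi)-\pi_\alpha(\varphi)\bigr\|^2\ \le\ 9\,n^{-1}\,m_\alpha\,2^{-d/2}\,\frac{C_{f,\|\bar\varphi\|^2/g_0}}{2\alpha}\Bigl(1+\frac C\alpha\Bigr).$$ -/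

import Mathlib

open MeasureTheory ProbabilityTheory Real

namespace LISO

noncomputable section

/-- `ℝ^d` with its Euclidean norm. -/
abbrev E (d : ℕ) := EuclideanSpace ℝ (Fin d)

/-- The `i`-th standard basis vector of `ℝ^d`. -/
def bvec (d : ℕ) (i : Fin d) : E d := EuclideanSpace.single i 1

/-- The normalizing constant `Z_α = ∫ exp (-α f)`. -/
def Zc {d : ℕ} (f : E d → ℝ) (α : ℝ) : ℝ := ∫ x, Real.exp (-α * f x)

/-- The measure `π_α` with density `exp (-α f) / Z_α`. -/
def gibbs {d : ℕ} (f : E d → ℝ) (α : ℝ) : Measure (E d) :=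
  volume.withDensity fun x => ENNReal.ofReal (Real.exp (-α * f x) / Zc f α)

/-- The gradient of `ψ` at `x`, in coordinates. -/
def grad {d : ℕ} (ψ : E d → ℝ) (x : E d) : Fin d → ℝ :=
  fun i => fderiv ℝ ψ x (bvec d i)

/-- The Hessian matrix of `ψ` at `x`. -/
def hess {d : ℕ} (ψ : E d → ℝ) (x : E d) : Matrix (Fin d) (Fin d) ℝ :=
  Matrix.of fun i j => iteratedFDeriv ℝ 2 ψ x ![bvec d i, bvec d j]

/-- `m_α = √(det H_f(x)) · (α/(2π))^{d/2}`. -/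
def mconst {d : ℕ} (f : E d → ℝ) (x : E d) (α : ℝ) : ℝ :=
  Real.sqrt (hess f x).det * (α / (2 * π)) ^ ((d : ℝ) / 2)

/-- The partial trace of `D³ f` at `x`, the trace being taken with respect to the inverse Hessian:
its `i`-th entry is `∑_{k,l} (H_f(x)⁻¹)_{kl} ∂_i∂_k∂_l f(x)`. -/
def ptr3 {d : ℕ} (f : E d → ℝ) (x : E d) : Fin d → ℝ :=
  fun i => ∑ k, ∑ l, (hess f x)⁻¹ k l * iteratedFDeriv ℝ 3 f x ![bvec d i, bvec d k, bvec d l]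

/-- The Laplace constant
`C_{f,ψ} = |Tr (H_f(x)⁻¹ H_ψ(x)) - ⟨H_f(x)⁻¹ ∇ψ(x), PTr (D³f(x))⟩|`. -/
def laplaceConst {d : ℕ} (f : E d → ℝ) (x : E d) (ψ : E d → ℝ) : ℝ :=
  |((hess f x)⁻¹ * hess ψ x).trace - ((hess f x)⁻¹.mulVec (grad ψ x)) ⬝ᵥ ptr3 f x|

/-- `p` is a (Borel measurable) probability density on `ℝ^d`. -/
def IsProbDensity {d : ℕ} (p : E d → ℝ) : Prop :=
  Measurable p ∧ (∀ x, 0 ≤ p x) ∧ ∫⁻ x, ENNReal.ofReal (p x) = 1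

/-- Adaptive sampling with policies in `𝒬`: the samples are `X 1, X 2, …` (`X 0` is not used) and
`X (i + 1)` is drawn from the density `p i`; the density `p 0` is deterministic, and for `i ≥ 1`
the density `p i` is random, known at time `i`, and is the conditional density of `X (i + 1)`
given `F i`. -/
structure IsAdaptiveSampling {d : ℕ} (𝒬 : Set (E d → ℝ)) {Ω : Type*} {mΩ : MeasurableSpace Ω}
    (μ : Measure Ω) (F : Filtration ℕ mΩ) (X : ℕ → Ω → E d) (p : ℕ → Ω → E d → ℝ) : Prop where
  adapted : ∀ i, 1 ≤ i → Measurable[F i] (X i)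
  init : ∃ q₀ ∈ 𝒬, (∀ ω, p 0 ω = q₀) ∧
    μ.map (X 1) = volume.withDensity fun x => ENNReal.ofReal (q₀ x)
  density_measurable : ∀ i, 1 ≤ i →
    @Measurable (Ω × E d) ℝ ((F i).prod inferInstance) _ (Function.uncurry (p i))
  density_mem : ∀ i, 1 ≤ i → ∀ᵐ ω ∂μ, p i ω ∈ 𝒬
  cond_density : ∀ i, 1 ≤ i → ∀ s : Set (E d), MeasurableSet s →
    μ[(X (i + 1) ⁻¹' s).indicator (fun _ => (1 : ℝ)) | F i] =ᵐ[μ] fun ω => ∫ x in s, p i ω x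

/-- The importance weight `exp (-α f(X^{i+1})) / q_i(X^{i+1})` of the sample `X^{i+1}`. -/
def weight {d : ℕ} {Ω : Type*} (f : E d → ℝ) (α : ℝ) (X : ℕ → Ω → E d) (p : ℕ → Ω → E d → ℝ)
    (i : ℕ) (ω : Ω) : ℝ :=
  Real.exp (-α * f (X (i + 1) ω)) / p i ω (X (i + 1) ω)

/-- The adaptive self-normalized estimator built from `X^1, …, X^n`. -/
def estimator {d q : ℕ} {Ω : Type*} (f : E d → ℝ) (φ : E d → E q) (α : ℝ)
    (X : ℕ → Ω → E d) (p : ℕ → Ω → E d → ℝ) (n : ℕ) (ω : Ω) : E q :=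
  (∑ i ∈ Finset.range n, weight f α X p i ω)⁻¹ •
    ∑ i ∈ Finset.range n, weight f α X p i ω • φ (X (i + 1) ω)

end

end LISO

open LISO

open Filter Topology Asymptotics
open scoped ENNReal

namespace LISO

/-- The quadratic form `y ↦ yᵀ B y` on `ℝ^d`. -/
noncomputable def qform {d : ℕ} (B : Matrix (Fin d) (Fin d) ℝ) (y : E d) : ℝ :=
  ∑ i, ∑ j, B i j * (y i * y j)

lemma continuous_qform {d : ℕ} (B : Matrix (Fin d) (Fin d) ℝ) : Continuous (qform B) := by
  unfold qform; fun_prop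

lemma qform_smul {d : ℕ} (B : Matrix (Fin d) (Fin d) ℝ) (t : ℝ) (y : E d) :
    qform B (t • y) = t ^ 2 * qform B y := by
  simp only [qform, Finset.mul_sum, PiLp.smul_apply, smul_eq_mul]
  refine Finset.sum_congr rfl fun i _ => Finset.sum_congr rfl fun j _ => by ring

lemma sum_bvec {d : ℕ} (y : E d) : ∑ i, y i • bvec d i = y := by
  ext j
  simp [bvec, Pi.single_apply]

lemma qform_hess {d : ℕ} (ψ : E d → ℝ) (x y : E d) :
    fderiv ℝ (fderiv ℝ ψ) x y y = qform (hess ψ x) y := by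
  conv_lhs => rw [← sum_bvec y]
  simp only [map_sum, map_smul, sum_apply, smul_apply,
    smul_eq_mul, Finset.mul_sum, qform, hess, Matrix.of_apply, iteratedFDeriv_two_apply]
  rw [Finset.sum_comm]
  refine Finset.sum_congr rfl fun i _ => Finset.sum_congr rfl fun j _ => ?_
  simp
  ring

/-- Second order Taylor expansion, with Peano remainder, at a critical point. -/
lemma isLittleO_sub_qform_hess {d : ℕ} {ψ : E d → ℝ} {x₀ : E d} (hψ : ContDiff ℝ 2 ψ)
    (hcrit : fderiv ℝ ψ x₀ = 0) :
    (fun x => ψ x - ψ x₀ - qform (hess ψ x₀) (x - x₀) / 2) =o[𝓝 x₀]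
      fun x => ‖x - x₀‖ ^ 2 := by
  set B := fderiv ℝ (fderiv ℝ ψ) x₀ with hB
  have hd1 : Differentiable ℝ ψ := hψ.differentiable (by norm_num)
  have hd2 : Differentiable ℝ (fderiv ℝ ψ) :=
    (hψ.fderiv_right (m := 1) (by norm_num)).differentiable (by norm_num)
  have hsymm : ∀ v w, B v w = B w v :=
    (hψ.contDiffAt (x := x₀)).isSymmSndFDerivAt (by simp)
  have hdiff : ∀ x, HasFDerivAt (fun x => ψ x - ψ x₀ - B (x - x₀) (x - x₀) / 2)
      (fderiv ℝ ψ x - B (x - x₀)) x := by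
    intro x
    have h1 := (hd1 x).hasFDerivAt
    have h2 : HasFDerivAt (fun x => x - x₀) (ContinuousLinearMap.id ℝ (E d)) x :=
      (hasFDerivAt_id x).sub_const x₀
    have h3 : HasFDerivAt (fun x => B (x - x₀)) B x := by
      exact (B.hasFDerivAt (x := x - x₀)).comp x h2
    have h4 := h3.clm_apply h2
    have h5 := (h1.sub_const (ψ x₀)).sub (h4.mul_const (1 / 2 : ℝ))
    refine (h5.congr_fderiv ?_).congr_of_eventuallyEq (Eventually.of_forall fun z => ?_)
    · ext v
      simp only [sub_apply, smul_apply, add_apply,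
        ContinuousLinearMap.comp_apply, ContinuousLinearMap.id_apply,
        ContinuousLinearMap.flip_apply, smul_eq_mul]
      rw [hsymm v]
      ring
    · simp; ring
  have ho : (fun x => fderiv ℝ ψ x - B (x - x₀)) =o[𝓝 x₀] fun x => ‖x - x₀‖ ^ 1 := by
    have := (hd2 x₀).hasFDerivAt.isLittleO
    simp only [hcrit, sub_zero, pow_one] at this ⊢
    exact this.norm_right
  have := Convex.isLittleO_pow_succ (s := Set.univ) convex_univ (Set.mem_univ x₀)
    (fun x _ => (hdiff x).hasFDerivWithinAt) (n := 1) (by simpa only [nhdsWithin_univ] using ho)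
  simp only [nhdsWithin_univ, sub_self, map_zero, zero_div, sub_zero, Nat.reduceAdd] at this
  refine this.congr_left fun x => ?_
  simp only [hB, qform_hess]

lemma integrable_exp_neg_mul_sq_norm {d : ℕ} {b : ℝ} (hb : 0 < b) :
    Integrable fun y : E d => Real.exp (-b * ‖y‖ ^ 2) := by
  have h := GaussianFourier.integrable_cexp_neg_mul_sq_norm_add (V := E d) (b := (b : ℂ))
    (by simpa using hb) 0 0
  have h2 := h.norm
  refine h2.congr (Eventually.of_forall fun y => ?_)
  simp only [Complex.norm_exp]
  congr 1
  simp [← Complex.ofReal_pow, ← Complex.ofReal_neg, ← Complex.ofReal_mul]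

lemma integrable_norm_pow_mul_exp_neg {d : ℕ} {b : ℝ} (hb : 0 < b) (s : ℕ) :
    Integrable fun y : E d => ‖y‖ ^ (2 * s) * Real.exp (-b * ‖y‖ ^ 2) := by
  refine ((integrable_exp_neg_mul_sq_norm (d := d) (half_pos hb)).const_mul
    (s.factorial * (b / 2)⁻¹ ^ s)).mono' (by fun_prop) (Eventually.of_forall fun y => ?_)
  rw [Real.norm_of_nonneg (by positivity)]
  have h := Real.pow_div_factorial_le_exp (b / 2 * ‖y‖ ^ 2) (by positivity) s
  have hf : (0 : ℝ) < s.factorial := by positivity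
  rw [div_le_iff₀ hf] at h
  have e : Real.exp (-b * ‖y‖ ^ 2)
      = Real.exp (-(b / 2) * ‖y‖ ^ 2) * (Real.exp (b / 2 * ‖y‖ ^ 2))⁻¹ := by
    rw [← Real.exp_neg, ← Real.exp_add]; congr 1; ring
  have hp : ‖y‖ ^ (2 * s) = (b / 2)⁻¹ ^ s * (b / 2 * ‖y‖ ^ 2) ^ s := by
    rw [← mul_pow, ← mul_assoc, inv_mul_cancel₀ (by positivity), one_mul, pow_mul]
  rw [e, hp]
  calc _ ≤ (b / 2)⁻¹ ^ s * (Real.exp (b / 2 * ‖y‖ ^ 2) * s.factorial) *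
      (Real.exp (-(b / 2) * ‖y‖ ^ 2) * (Real.exp (b / 2 * ‖y‖ ^ 2))⁻¹) := by gcongr
    _ = _ := by
      have := (Real.exp_pos (b / 2 * ‖y‖ ^ 2)).ne'
      field_simp

lemma exists_linearMap_norm_sq_eq_qform {d : ℕ} {H : Matrix (Fin d) (Fin d) ℝ} (hH : H.PosDef) :
    ∃ T : E d →ₗ[ℝ] E d, (∀ y, ‖T y‖ ^ 2 = qform H y) ∧ LinearMap.det T ^ 2 = H.det := by
  obtain ⟨R, hR⟩ : ∃ R : Matrix (Fin d) (Fin d) ℝ, H = R.transpose * R := by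
    open scoped MatrixOrder in
    obtain ⟨B, hB⟩ := CStarAlgebra.nonneg_iff_eq_star_mul_self.mp hH.posSemidef.nonneg
    exact ⟨B, by rw [hB, Matrix.star_eq_conjTranspose, Matrix.conjTranspose_eq_transpose_of_trivial]⟩
  refine ⟨Matrix.toLpLin 2 2 R, fun y => ?_, ?_⟩
  · rw [EuclideanSpace.real_norm_sq_eq, hR]
    simp only [Matrix.toLpLin_apply, qform, Matrix.mul_apply, Matrix.transpose_apply,
      Matrix.mulVec, dotProduct, sq, Finset.sum_mul, Finset.mul_sum]
    rw [Finset.sum_comm]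
    refine Finset.sum_congr rfl fun i _ => ?_
    rw [Finset.sum_comm]
    refine Finset.sum_congr rfl fun j _ => Finset.sum_congr rfl fun k _ => by ring
  · rw [Matrix.toLpLin_eq_toLin, LinearMap.det_toLin, hR, Matrix.det_mul, Matrix.det_transpose, sq]

lemma exists_norm_sq_le_qform {d : ℕ} {H : Matrix (Fin d) (Fin d) ℝ} (hH : H.PosDef) :
    ∃ κ > 0, ∀ y : E d, κ * ‖y‖ ^ 2 ≤ qform H y := by
  obtain ⟨T, hT, hdet⟩ := exists_linearMap_norm_sq_eq_qform hH
  have hdet0 : LinearMap.det T ≠ 0 := by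
    intro h; rw [h] at hdet; exact hH.det_pos.ne' (by rw [← hdet]; simp)
  have hker : LinearMap.ker T = ⊥ := by
    by_contra h
    exact hdet0 (LinearMap.det_eq_zero_iff_ker_ne_bot.2 h)
  obtain ⟨K, hK0, hK⟩ := T.exists_antilipschitzWith hker
  have hK0' : (0 : ℝ) < K := by exact_mod_cast hK0
  refine ⟨((K : ℝ) ^ 2)⁻¹, by positivity, fun y => ?_⟩
  have h := hK.le_mul_dist y 0
  rw [dist_zero_right, map_zero, dist_zero_right] at h
  rw [← hT, inv_mul_le_iff₀ (by positivity), ← mul_pow]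
  gcongr

lemma integral_exp_neg_qform {d : ℕ} {H : Matrix (Fin d) (Fin d) ℝ} (hH : H.PosDef) :
    ∫ y : E d, Real.exp (-(qform H y / 2)) = (2 * π) ^ ((d : ℝ) / 2) / √H.det := by
  obtain ⟨T, hT, hdet⟩ := exists_linearMap_norm_sq_eq_qform hH
  have hdet0 : LinearMap.det T ≠ 0 := by
    intro h; rw [h] at hdet; exact hH.det_pos.ne' (by rw [← hdet]; simp)
  have hmap := Measure.map_linearMap_addHaar_eq_smul_addHaar (volume : Measure (E d)) hdet0
  have hc : Continuous T := T.continuous_of_finiteDimensional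
  have h1 : ∫ y : E d, Real.exp (-(qform H y / 2))
      = ∫ z, Real.exp (-(1 / 2) * ‖z‖ ^ 2) ∂(Measure.map T volume) := by
    rw [integral_map hc.aemeasurable (by fun_prop)]
    refine integral_congr_ae (Eventually.of_forall fun y => ?_)
    simp only [← hT]
    congr 1; ring
  rw [h1, hmap, integral_smul_measure,
    GaussianFourier.integral_rexp_neg_mul_sq_norm (by norm_num : (0 : ℝ) < 1 / 2),
    ENNReal.toReal_ofReal (abs_nonneg _), ← hdet, Real.sqrt_sq_eq_abs, abs_inv, smul_eq_mul,
    finrank_euclideanSpace_fin, div_eq_mul_inv _ |LinearMap.det T|, mul_comm]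
  congr 2
  ring

lemma integrable_qform_exp {d : ℕ} {H : Matrix (Fin d) (Fin d) ℝ} (hH : H.PosDef) {P : E d → ℝ}
    (hP : Continuous P) (s : ℕ) {K : ℝ} (hK : ∀ y, |P y| ≤ K * ‖y‖ ^ (2 * s)) :
    Integrable fun y => P y * Real.exp (-(qform H y / 2)) := by
  obtain ⟨κ, hκ, h⟩ := exists_norm_sq_le_qform hH
  have := continuous_qform H
  refine ((integrable_norm_pow_mul_exp_neg (d := d) (half_pos hκ) s).const_mul K).mono'
    (by fun_prop) (Eventually.of_forall fun y => ?_)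
  rw [norm_mul, Real.norm_eq_abs, Real.norm_of_nonneg (Real.exp_nonneg _), ← mul_assoc]
  refine mul_le_mul (hK y) ?_ (Real.exp_nonneg _) ((abs_nonneg _).trans (hK y))
  rw [Real.exp_le_exp]
  linarith [h y]

lemma abs_apply_mul_apply_le {d : ℕ} (y : E d) (i j : Fin d) : |y i * y j| ≤ ‖y‖ ^ (2 * 1) := by
  rw [abs_mul, mul_one, sq]
  exact mul_le_mul (PiLp.norm_apply_le y i) (PiLp.norm_apply_le y j) (abs_nonneg _) (norm_nonneg _)

lemma hasFDerivAt_exp_neg_qform {d : ℕ} {H : Matrix (Fin d) (Fin d) ℝ} (hH : H.IsSymm) (y : E d)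
    (k : Fin d) :
    DifferentiableAt ℝ (fun y : E d => Real.exp (-(qform H y / 2))) y ∧
    fderiv ℝ (fun y : E d => Real.exp (-(qform H y / 2))) y (bvec d k) =
      -(∑ j, H k j * y j) * Real.exp (-(qform H y / 2)) := by
  have hd : Differentiable ℝ (fun y : E d => Real.exp (-(qform H y / 2))) := by
    unfold qform; fun_prop
  refine ⟨hd y, ?_⟩
  have hl : HasLineDerivAt ℝ (fun y : E d => Real.exp (-(qform H y / 2)))
      (-(∑ j, H k j * y j) * Real.exp (-(qform H y / 2))) y (bvec d k) := by
    have e : ∀ t : ℝ, qform H (y + t • bvec d k)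
        = qform H y + t * (2 * ∑ j, H k j * y j) + t ^ 2 * H k k := by
      intro t
      simp only [qform, PiLp.add_apply, PiLp.smul_apply, smul_eq_mul, bvec, PiLp.single_apply]
      have : ∀ i j, H i j * ((y i + t * if i = k then 1 else 0) * (y j + t * if j = k then 1 else 0))
        = H i j * (y i * y j) + (if i = k then t * (H i j * y j) else 0)
          + (if j = k then t * (H i j * y i) else 0)
          + (if i = k then (if j = k then t ^ 2 * H i j else 0) else 0) := by
        intro i j; split_ifs <;> ring
      simp only [this, Finset.sum_add_distrib]
      have e2 : ∑ i, ∑ j, (if i = k then t * (H i j * y j) else 0) = t * ∑ j, H k j * y j := by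
        rw [Finset.sum_comm]; simp [Finset.mul_sum]
      have e3 : ∑ i, ∑ j, (if j = k then t * (H i j * y i) else 0) = t * ∑ j, H k j * y j := by
        simp only [Finset.sum_ite_eq', Finset.mem_univ, if_true, Finset.mul_sum]
        exact Finset.sum_congr rfl fun i _ => by rw [hH.apply]
      have e4 : ∑ i, ∑ j, (if i = k then (if j = k then t ^ 2 * H i j else 0) else 0)
          = t ^ 2 * H k k := by
        rw [Finset.sum_comm]; simp
      rw [e2, e3, e4]; ring
    unfold HasLineDerivAt
    simp only [e]
    have h1 : HasDerivAt (fun t : ℝ => -((qform H y + t * (2 * ∑ j, H k j * y j)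
        + t ^ 2 * H k k) / 2)) (-(∑ j, H k j * y j)) 0 := by
      have := ((((hasDerivAt_id (0 : ℝ)).mul_const (2 * ∑ j, H k j * y j)).const_add
        (qform H y)).add (((hasDerivAt_id (0 : ℝ)).pow 2).mul_const (H k k))).div_const 2 |>.neg
      refine (this.congr_deriv ?_)
      simp
    have h2 := h1.exp
    refine h2.congr_deriv ?_
    simp
    ring
  rw [← (hd y).lineDeriv_eq_fderiv, hl.lineDeriv]

lemma integral_apply_mul_mulVec_exp {d : ℕ} {H : Matrix (Fin d) (Fin d) ℝ} (hH : H.PosDef)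
    (i k : Fin d) :
    ∑ j, H k j * ∫ y : E d, (y i * y j) * Real.exp (-(qform H y / 2)) =
      (if i = k then 1 else 0) * ∫ y : E d, Real.exp (-(qform H y / 2)) := by
  have hsymm : H.IsSymm := hH.isHermitian
  have hint : ∀ i j, Integrable fun y : E d => (y i * y j) * Real.exp (-(qform H y / 2)) :=
    fun i j => integrable_qform_exp hH (by fun_prop) 1 (K := 1)
      (fun y => by simpa using abs_apply_mul_apply_le y i j)
  have hfd : ∀ y : E d, fderiv ℝ (fun y : E d => y i) y (bvec d k) = if i = k then 1 else 0 := by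
    intro y
    have : fderiv ℝ (fun y : E d => y i) y = (EuclideanSpace.proj i : E d →L[ℝ] ℝ) :=
      (EuclideanSpace.proj (𝕜 := ℝ) i).hasFDerivAt.fderiv
    rw [this]
    simp [bvec]
  have hint0 : Integrable fun y : E d => Real.exp (-(qform H y / 2)) := by
    simpa using integrable_qform_exp hH (P := fun _ => 1) (by fun_prop) 0 (K := 1) (by simp)
  have hint1 : Integrable fun y : E d => y i * Real.exp (-(qform H y / 2)) := by
    have h2 := (hint i i).add hint0
    have := continuous_qform H
    refine h2.mono' (by fun_prop) (Eventually.of_forall fun y => ?_)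
    rw [norm_mul, Real.norm_of_nonneg (Real.exp_nonneg _), Real.norm_eq_abs, Pi.add_apply,
      ← add_one_mul]
    gcongr
    rw [abs_le]; constructor <;> nlinarith [sq_nonneg (y i - 1), sq_nonneg (y i + 1)]
  have heq : ∀ y : E d, y i * (-(∑ j, H k j * y j) * Real.exp (-(qform H y / 2)))
      = -∑ j, H k j * ((y i * y j) * Real.exp (-(qform H y / 2))) := by
    intro y
    rw [neg_mul, mul_neg, Finset.sum_mul, Finset.mul_sum]
    congr 1
    exact Finset.sum_congr rfl fun j _ => by ring
  have hint2 : Integrable fun y : E d =>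
      -∑ j, H k j * ((y i * y j) * Real.exp (-(qform H y / 2))) :=
    (integrable_finsetSum _ fun j _ => (hint i j).const_mul _).neg
  have := integral_mul_fderiv_eq_neg_fderiv_mul_of_integrable (μ := (volume : Measure (E d)))
    (f := fun y : E d => y i) (g := fun y : E d => Real.exp (-(qform H y / 2))) (v := bvec d k)
    (by simp only [hfd]; exact hint0.const_mul _)
    (by simp only [(hasFDerivAt_exp_neg_qform hsymm _ k).2, heq]; exact hint2)
    hint1 (fun y _ => by fun_prop) (fun y _ => (hasFDerivAt_exp_neg_qform hsymm y k).1)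
  simp only [hfd, (hasFDerivAt_exp_neg_qform hsymm _ k).2, heq] at this
  rw [integral_neg, neg_inj, integral_finsetSum _ fun j _ => (hint i j).const_mul _] at this
  simpa only [integral_const_mul] using this

lemma integral_qform_mul_exp {d : ℕ} {H : Matrix (Fin d) (Fin d) ℝ} (hH : H.PosDef)
    (B : Matrix (Fin d) (Fin d) ℝ) :
    ∫ y : E d, qform B y * Real.exp (-(qform H y / 2)) =
      (H⁻¹ * B).trace * ∫ y : E d, Real.exp (-(qform H y / 2)) := by
  have hint : ∀ i j, Integrable fun y : E d => (y i * y j) * Real.exp (-(qform H y / 2)) :=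
    fun i j => integrable_qform_exp hH (by fun_prop) 1 (K := 1)
      (fun y => by simpa using abs_apply_mul_apply_le y i j)
  set G := ∫ y : E d, Real.exp (-(qform H y / 2)) with hG
  set S : Matrix (Fin d) (Fin d) ℝ :=
    Matrix.of fun j i => ∫ y : E d, (y i * y j) * Real.exp (-(qform H y / 2)) with hS
  have hHS : H * S = G • 1 := by
    ext k i
    rw [Matrix.mul_apply]
    simp only [hS, Matrix.of_apply, Matrix.smul_apply, Matrix.one_apply, smul_eq_mul]
    rw [integral_apply_mul_mulVec_exp hH i k, mul_comm]
    simp [eq_comm, hG]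
  have hSeq : S = G • H⁻¹ := by
    have hu : IsUnit H.det := hH.det_pos.ne'.isUnit
    calc S = H⁻¹ * (H * S) := by rw [← Matrix.mul_assoc, Matrix.nonsing_inv_mul _ hu, one_mul]
      _ = G • H⁻¹ := by rw [hHS]; simp
  have : ∫ y : E d, qform B y * Real.exp (-(qform H y / 2)) = (S * B).trace := by
    have e : ∀ y : E d, qform B y * Real.exp (-(qform H y / 2)) =
        ∑ i, ∑ j, B i j * (y i * y j * Real.exp (-(qform H y / 2))) := fun y => by
      rw [qform]; simp only [Finset.sum_mul, mul_assoc]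
    simp only [e]
    rw [integral_finsetSum _ fun i _ => integrable_finsetSum _ fun j _ =>
      (hint i j).const_mul (B i j)]
    rw [Matrix.trace]
    simp only [Matrix.diag_apply, Matrix.mul_apply]
    rw [Finset.sum_comm]
    refine Finset.sum_congr rfl fun i _ => ?_
    rw [integral_finsetSum _ fun j _ =>
      (hint i j).const_mul (B i j)]
    refine Finset.sum_congr rfl fun j _ => ?_
    rw [integral_const_mul, hS, Matrix.of_apply, mul_comm]
  rw [this, hSeq, Matrix.smul_mul, Matrix.trace_smul, smul_eq_mul, mul_comm]

lemma integrable_exp_neg_mul_of_le {d : ℕ} {U ψ : E d → ℝ} (hUm : Measurable U) (hU0 : ∀ x, 0 ≤ U x)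
    (hψm : Measurable ψ) {t₀ : ℝ} (hint : Integrable fun x => Real.exp (-t₀ * U x) * ψ x) {t : ℝ} (ht : t₀ ≤ t) :
    Integrable fun x => Real.exp (-t * U x) * ψ x := by
  refine hint.norm.mono' (by fun_prop) (Eventually.of_forall fun x => ?_)
  rw [norm_mul, norm_mul, Real.norm_of_nonneg (Real.exp_nonneg _),
    Real.norm_of_nonneg (Real.exp_nonneg _)]
  gcongr
  nlinarith [hU0 x]

/-- The contribution of the complement of a neighbourhood of the minimizer is negligible. -/
lemma tendsto_laplace_tail {d : ℕ} {U ψ : E d → ℝ} (hUm : Measurable U) (hU0 : ∀ x, 0 ≤ U x)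
    (hψm : Measurable ψ) {t₀ : ℝ} (hint : Integrable fun x => Real.exp (-t₀ * U x) * ψ x)
    {S : Set (E d)} (hS : MeasurableSet S) {η : ℝ} (hη : 0 < η) (hSη : ∀ x ∈ S, η ≤ U x) (s : ℕ) :
    Tendsto (fun t : ℝ => t ^ ((d : ℝ) / 2) * t ^ s * ∫ x in S, Real.exp (-t * U x) * ψ x)
      atTop (𝓝 0) := by
  set J := ∫ x, ‖Real.exp (-t₀ * U x) * ψ x‖ with hJ
  have hb : Tendsto (fun t : ℝ => (Real.exp (t₀ * η) * J) * (t ^ ((d : ℝ) / 2 + s) * Real.exp (-η * t)))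
      atTop (𝓝 0) := by
    simpa using (tendsto_rpow_mul_exp_neg_mul_atTop_nhds_zero ((d : ℝ) / 2 + s) η hη).const_mul
      (Real.exp (t₀ * η) * J)
  refine squeeze_zero_norm' ?_ hb
  filter_upwards [eventually_ge_atTop t₀, eventually_gt_atTop 0] with t ht h0
  have h1 : ‖∫ x in S, Real.exp (-t * U x) * ψ x‖ ≤ Real.exp (-(t - t₀) * η) * J := by
    calc ‖∫ x in S, Real.exp (-t * U x) * ψ x‖
        ≤ ∫ x in S, ‖Real.exp (-t * U x) * ψ x‖ := norm_integral_le_integral_norm _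
      _ ≤ ∫ x in S, Real.exp (-(t - t₀) * η) * ‖Real.exp (-t₀ * U x) * ψ x‖ := by
          refine setIntegral_mono_on
            (integrable_exp_neg_mul_of_le hUm hU0 hψm hint ht).norm.integrableOn
            (hint.norm.const_mul _).integrableOn hS fun x hx => ?_
          rw [norm_mul, norm_mul, Real.norm_of_nonneg (Real.exp_nonneg _),
            Real.norm_of_nonneg (Real.exp_nonneg _), ← mul_assoc, ← Real.exp_add]
          gcongr
          nlinarith [hSη x hx]
      _ ≤ ∫ x, Real.exp (-(t - t₀) * η) * ‖Real.exp (-t₀ * U x) * ψ x‖ :=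
          setIntegral_le_integral (hint.norm.const_mul _)
            (Eventually.of_forall fun x => by positivity)
      _ = _ := by rw [integral_const_mul]
  rw [norm_mul, Real.norm_of_nonneg (by positivity)]
  calc _ ≤ t ^ ((d : ℝ) / 2) * t ^ s * (Real.exp (-(t - t₀) * η) * J) := by gcongr
    _ = _ := by
      rw [Real.rpow_add h0, Real.rpow_natCast]
      have : Real.exp (-(t - t₀) * η) = Real.exp (t₀ * η) * Real.exp (-η * t) := by
        rw [← Real.exp_add]; congr 1; ring
      rw [this]; ring

/-- Laplace's method at a nondegenerate minimizer `x₀` of `U`, for an integrand which agrees to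
leading order with a function that is homogeneous of degree `2 s` in `x - x₀`. -/
theorem tendsto_laplace {d : ℕ} {U ψ P : E d → ℝ} {x₀ : E d} {H : Matrix (Fin d) (Fin d) ℝ}
    (hH : H.PosDef) (hUm : Measurable U) (hU0 : ∀ x, 0 ≤ U x)
    (hU : (fun x => U x - qform H (x - x₀) / 2) =o[𝓝 x₀] fun x => ‖x - x₀‖ ^ 2)
    (hsep : ∀ δ > (0 : ℝ), ∃ η > (0 : ℝ), ∀ x, δ ≤ ‖x - x₀‖ → η ≤ U x)
    (hψm : Measurable ψ) {t₀ : ℝ} (hint : Integrable fun x => Real.exp (-t₀ * U x) * ψ x) (s : ℕ)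
    (hPhom : ∀ t y, P (t • y) = t ^ (2 * s) * P y)
    {K : ℝ} (hPK : ∀ y, |P y| ≤ K * ‖y‖ ^ (2 * s))
    (hψ : (fun x => ψ x - P (x - x₀)) =o[𝓝 x₀] fun x => ‖x - x₀‖ ^ (2 * s)) :
    Tendsto (fun t : ℝ => t ^ ((d : ℝ) / 2) * t ^ s * ∫ x, Real.exp (-t * U x) * ψ x)
      atTop (𝓝 (∫ y, P y * Real.exp (-(qform H y / 2)))) := by
  obtain ⟨κ, hκ, hκH⟩ := exists_norm_sq_le_qform hH
  have hUnear : ∀ᶠ x in 𝓝 x₀, κ / 4 * ‖x - x₀‖ ^ 2 ≤ U x := by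
    filter_upwards [hU.bound (show (0 : ℝ) < κ / 4 by positivity)] with x hx
    rw [Real.norm_eq_abs, abs_le, Real.norm_of_nonneg (by positivity)] at hx
    linarith [hκH (x - x₀), hx.1]
  have hψnear : ∀ᶠ x in 𝓝 x₀, |ψ x| ≤ (K + 1) * ‖x - x₀‖ ^ (2 * s) := by
    filter_upwards [hψ.bound one_pos] with x hx
    rw [Real.norm_eq_abs, Real.norm_of_nonneg (by positivity)] at hx
    have := abs_sub_abs_le_abs_sub (ψ x) (P (x - x₀))
    linarith [hPK (x - x₀)]
  obtain ⟨δ, hδ, hball⟩ := Metric.eventually_nhds_iff_ball.1 (hUnear.and hψnear)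
  obtain ⟨η, hη, hηU⟩ := hsep δ hδ
  have htail := tendsto_laplace_tail hUm hU0 hψm hint
    (S := (Metric.ball x₀ δ)ᶜ) Metric.isOpen_ball.measurableSet.compl hη
    (fun x hx => hηU x (by simpa [dist_eq_norm] using hx)) s
  set F : ℝ → E d → ℝ := fun t y =>
    (Metric.ball x₀ δ).indicator (fun x => Real.exp (-t * U x) * (t ^ s * ψ x)) (x₀ + (√t)⁻¹ • y)
    with hF
  have hmain : Tendsto (fun t : ℝ => ∫ y, F t y) atTop
      (𝓝 (∫ y, P y * Real.exp (-(qform H y / 2)))) := by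
    refine tendsto_integral_filter_of_dominated_convergence
      (fun y => (K + 1) * (‖y‖ ^ (2 * s) * Real.exp (-(κ / 4) * ‖y‖ ^ 2))) ?_ ?_ ?_ ?_
    · refine Eventually.of_forall fun t => Measurable.aestronglyMeasurable ?_
      refine Measurable.comp (g := (Metric.ball x₀ δ).indicator _) ?_ (by fun_prop)
      exact Measurable.indicator (by fun_prop) Metric.isOpen_ball.measurableSet
    · filter_upwards [eventually_gt_atTop 0] with t ht
      refine Eventually.of_forall fun y => ?_
      have hst : 0 < √t := Real.sqrt_pos.2 ht
      simp only [hF]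
      by_cases hx : x₀ + (√t)⁻¹ • y ∈ Metric.ball x₀ δ
      · rw [Set.indicator_of_mem hx]
        obtain ⟨h1, h2⟩ := hball _ hx
        have hn : ‖x₀ + (√t)⁻¹ • y - x₀‖ = (√t)⁻¹ * ‖y‖ := by
          rw [add_sub_cancel_left, norm_smul, Real.norm_of_nonneg (by positivity)]
        have hn2 : (√t)⁻¹ ^ 2 = t⁻¹ := by rw [inv_pow, Real.sq_sqrt ht.le]
        rw [hn, mul_pow, hn2] at h1
        rw [hn, mul_pow, pow_mul, hn2] at h2
        rw [norm_mul, norm_mul, Real.norm_of_nonneg (Real.exp_nonneg _),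
          Real.norm_of_nonneg (pow_nonneg ht.le _), Real.norm_eq_abs]
        have hexp : Real.exp (-t * U (x₀ + (√t)⁻¹ • y)) ≤ Real.exp (-(κ / 4) * ‖y‖ ^ 2) := by
          rw [Real.exp_le_exp]
          have := mul_le_mul_of_nonneg_left h1 ht.le
          have e : t * (κ / 4 * (t⁻¹ * ‖y‖ ^ 2)) = κ / 4 * ‖y‖ ^ 2 := by field_simp
          linarith
        calc _ ≤ Real.exp (-(κ / 4) * ‖y‖ ^ 2) * (t ^ s * ((K + 1) * (t⁻¹ ^ s * ‖y‖ ^ (2 * s)))) := by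
              gcongr
          _ = _ := by rw [inv_pow]; field_simp
      · rw [Set.indicator_of_notMem hx, norm_zero]
        have : 0 ≤ (K + 1) * ‖y‖ ^ (2 * s) := by
          have := (abs_nonneg _).trans (hPK y)
          nlinarith [pow_nonneg (norm_nonneg y) (2 * s)]
        rw [← mul_assoc]
        exact mul_nonneg this (Real.exp_nonneg _)
    · exact (integrable_norm_pow_mul_exp_neg (by positivity) s).const_mul _
    · refine Eventually.of_forall fun y => ?_
      have hz : Tendsto (fun t : ℝ => x₀ + (√t)⁻¹ • y) atTop (𝓝 x₀) := by
        have : Tendsto (fun t : ℝ => (√t)⁻¹) atTop (𝓝 0) :=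
          tendsto_inv_atTop_zero.comp Real.tendsto_sqrt_atTop
        simpa using (this.smul_const y).const_add x₀
      have hin : ∀ᶠ t : ℝ in atTop, x₀ + (√t)⁻¹ • y ∈ Metric.ball x₀ δ :=
        hz.eventually (Metric.ball_mem_nhds x₀ hδ)
      have hscale : ∀ (r : ℕ) (R : E d → ℝ), R =o[𝓝 x₀] (fun x => ‖x - x₀‖ ^ (2 * r)) →
          Tendsto (fun t : ℝ => t ^ r * R (x₀ + (√t)⁻¹ • y)) atTop (𝓝 0) := by
        intro r R hR
        have h1 := hR.comp_tendsto hz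
        have h2 : (fun t : ℝ => t ^ r * R (x₀ + (√t)⁻¹ • y)) =o[atTop]
            fun t : ℝ => t ^ r * ‖x₀ + (√t)⁻¹ • y - x₀‖ ^ (2 * r) :=
          (isBigO_refl _ _).mul_isLittleO h1
        have h3 : (fun t : ℝ => t ^ r * ‖x₀ + (√t)⁻¹ • y - x₀‖ ^ (2 * r)) =ᶠ[atTop]
            fun _ => ‖y‖ ^ (2 * r) := by
          filter_upwards [eventually_gt_atTop 0] with t ht
          have hst : 0 < √t := Real.sqrt_pos.2 ht
          rw [add_sub_cancel_left, norm_smul, Real.norm_of_nonneg (by positivity), mul_pow, pow_mul,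
            inv_pow, Real.sq_sqrt ht.le, inv_pow]
          field_simp
        have h4 := h2.trans_eventuallyEq h3
        exact (isLittleO_one_iff ℝ).1 (h4.trans_isBigO (isBigO_const_const _ one_ne_zero _))
      have hUlim : Tendsto (fun t : ℝ => t * U (x₀ + (√t)⁻¹ • y)) atTop (𝓝 (qform H y / 2)) := by
        have h := (hscale 1 _ (by simpa using hU)).add_const (qform H y / 2)
        rw [zero_add] at h
        refine h.congr' ?_
        filter_upwards [eventually_gt_atTop 0] with t ht
        rw [add_sub_cancel_left, qform_smul, inv_pow, Real.sq_sqrt ht.le]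
        field_simp
        ring
      have hψlim : Tendsto (fun t : ℝ => t ^ s * ψ (x₀ + (√t)⁻¹ • y)) atTop (𝓝 (P y)) := by
        have h := (hscale s _ hψ).add_const (P y)
        rw [zero_add] at h
        refine h.congr' ?_
        filter_upwards [eventually_gt_atTop 0] with t ht
        rw [add_sub_cancel_left, hPhom, pow_mul, inv_pow, Real.sq_sqrt ht.le, inv_pow]
        field_simp
        ring
      have h := ((Real.continuous_exp.tendsto _).comp hUlim.neg).mul hψlim
      rw [mul_comm] at h
      refine h.congr' ?_
      filter_upwards [hin] with t ht
      simp only [hF, Set.indicator_of_mem ht, Function.comp, neg_mul]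
  have hsum := hmain.add htail
  rw [add_zero] at hsum
  refine hsum.congr' ?_
  filter_upwards [eventually_ge_atTop t₀, eventually_gt_atTop 0] with t ht h0
  have hsplit := integral_add_compl (s := Metric.ball x₀ δ) Metric.isOpen_ball.measurableSet
    (integrable_exp_neg_mul_of_le hUm hU0 hψm hint ht)
  have hFint : ∫ y, F t y
      = t ^ ((d : ℝ) / 2) * t ^ s * ∫ x in Metric.ball x₀ δ, Real.exp (-t * U x) * ψ x := by
    have h1 := Measure.integral_comp_inv_smul_of_nonneg (volume : Measure (E d))
      (fun z => (Metric.ball x₀ δ).indicator (fun x => Real.exp (-t * U x) * (t ^ s * ψ x)) (x₀ + z))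
      (Real.sqrt_nonneg t)
    have h2 := integral_add_left_eq_self (μ := (volume : Measure (E d)))
      (fun z => (Metric.ball x₀ δ).indicator (fun x => Real.exp (-t * U x) * (t ^ s * ψ x)) z) x₀
    rw [h2, integral_indicator Metric.isOpen_ball.measurableSet, finrank_euclideanSpace_fin,
      smul_eq_mul] at h1
    rw [hF]
    simp only
    rw [h1, Real.sqrt_eq_rpow, ← Real.rpow_natCast, ← Real.rpow_mul h0.le]
    have e : ∀ x, Real.exp (-t * U x) * (t ^ s * ψ x) = t ^ s * (Real.exp (-t * U x) * ψ x) :=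
      fun x => by ring
    simp only [e, integral_const_mul]
    rw [show (1 / 2 * (d : ℝ)) = d / 2 by ring, mul_assoc]
  rw [hFint, ← mul_add, hsplit]

/-- `U` is a nonnegative potential with a well separated nondegenerate zero at `x₀`, where its
Hessian is `H`, such that `exp (-U)` is integrable. -/
structure IsLaplacePotential {d : ℕ} (U : E d → ℝ) (x₀ : E d) (H : Matrix (Fin d) (Fin d) ℝ) :
    Prop where
  posDef : H.PosDef
  measurable : Measurable U
  nonneg : ∀ x, 0 ≤ U x
  isLittleO : (fun x => U x - qform H (x - x₀) / 2) =o[𝓝 x₀] fun x => ‖x - x₀‖ ^ 2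
  separated : ∀ δ > (0 : ℝ), ∃ η > (0 : ℝ), ∀ x, δ ≤ ‖x - x₀‖ → η ≤ U x
  integrable : Integrable fun x => Real.exp (-U x)

/-- The partition function `∫ exp (-α U)`. -/
noncomputable def partition {d : ℕ} (U : E d → ℝ) (α : ℝ) : ℝ := ∫ x, Real.exp (-α * U x)

/-- The mean of `φ` under the probability measure with density proportional to `exp (-α U)`. -/
noncomputable def gibbsMean {d q : ℕ} (U : E d → ℝ) (φ : E d → E q) (α : ℝ) : E q :=
  (partition U α)⁻¹ • ∫ x, Real.exp (-α * U x) • φ x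

/-- The Gaussian integral `∫ exp (- yᵀ H y / 2)`. -/
noncomputable def gaussConst {d : ℕ} (H : Matrix (Fin d) (Fin d) ℝ) : ℝ :=
  ∫ y : E d, Real.exp (-(qform H y / 2))

lemma gaussConst_eq {d : ℕ} {H : Matrix (Fin d) (Fin d) ℝ} (hH : H.PosDef) :
    gaussConst H = (2 * π) ^ ((d : ℝ) / 2) / √H.det := integral_exp_neg_qform hH

lemma gaussConst_pos {d : ℕ} {H : Matrix (Fin d) (Fin d) ℝ} (hH : H.PosDef) :
    0 < gaussConst H := by
  rw [gaussConst_eq hH]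
  have := Real.sqrt_pos.2 hH.det_pos
  positivity

namespace IsLaplacePotential

variable {d q : ℕ} {U : E d → ℝ} {x₀ : E d} {H : Matrix (Fin d) (Fin d) ℝ}

lemma integrable_exp (h : IsLaplacePotential U x₀ H) {t : ℝ} (ht : 1 ≤ t) :
    Integrable fun x => Real.exp (-t * U x) := by
  simpa using integrable_exp_neg_mul_of_le h.measurable h.nonneg (ψ := fun _ => 1) (by fun_prop)
    (t₀ := 1) (by simpa using h.integrable) ht

lemma partition_pos (h : IsLaplacePotential U x₀ H) {t : ℝ} (ht : 1 ≤ t) : 0 < partition U t :=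
  integral_exp_pos (h.integrable_exp ht)

/-- Leading order asymptotics for an integrand that is continuous at `x₀`. -/
lemma tendsto_of_continuousAt (h : IsLaplacePotential U x₀ H) {ψ : E d → ℝ} (hψm : Measurable ψ)
    (hψ : ContinuousAt ψ x₀) {t₀ : ℝ} (hint : Integrable fun x => Real.exp (-t₀ * U x) * ψ x) :
    Tendsto (fun t : ℝ => t ^ ((d : ℝ) / 2) * ∫ x, Real.exp (-t * U x) * ψ x)
      atTop (𝓝 (ψ x₀ * gaussConst H)) := by
  have := tendsto_laplace h.posDef h.measurable h.nonneg h.isLittleO h.separated hψm hint 0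
    (P := fun _ => ψ x₀) (K := |ψ x₀|) (by simp) (by simp)
    (by simpa using tendsto_sub_nhds_zero_iff.2 hψ.tendsto)
  simpa [gaussConst, integral_const_mul] using this

lemma abs_qform_le (B : Matrix (Fin d) (Fin d) ℝ) (y : E d) :
    |qform B y| ≤ (∑ i, ∑ j, |B i j|) * ‖y‖ ^ 2 := by
  simp only [qform, Finset.sum_mul]
  refine (Finset.abs_sum_le_sum_abs _ _).trans (Finset.sum_le_sum fun i _ => ?_)
  refine (Finset.abs_sum_le_sum_abs _ _).trans (Finset.sum_le_sum fun j _ => ?_)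
  rw [abs_mul]
  gcongr
  simpa using abs_apply_mul_apply_le y i j

/-- Leading order asymptotics for an integrand that is quadratic to leading order at `x₀`. -/
lemma tendsto_of_isLittleO (h : IsLaplacePotential U x₀ H) {ψ : E d → ℝ} (hψm : Measurable ψ)
    (B : Matrix (Fin d) (Fin d) ℝ) (c : ℝ)
    (hψ : (fun x => ψ x - c * (qform B (x - x₀) / 2)) =o[𝓝 x₀] fun x => ‖x - x₀‖ ^ 2)
    {t₀ : ℝ} (hint : Integrable fun x => Real.exp (-t₀ * U x) * ψ x) :
    Tendsto (fun t : ℝ => t ^ ((d : ℝ) / 2) * t * ∫ x, Real.exp (-t * U x) * ψ x)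
      atTop (𝓝 (c * ((H⁻¹ * B).trace / 2) * gaussConst H)) := by
  have := tendsto_laplace h.posDef h.measurable h.nonneg h.isLittleO h.separated hψm hint 1
    (P := fun y => c * (qform B y / 2)) (K := |c| * (∑ i, ∑ j, |B i j|) / 2)
    (fun t y => by rw [qform_smul]; ring)
    (fun y => by
      rw [abs_mul, abs_div, abs_two]
      have := abs_qform_le B y
      have := mul_le_mul_of_nonneg_left this (abs_nonneg c)
      linarith)
    (by simpa using hψ)
  have e : ∀ y : E d, c * (qform B y / 2) * Real.exp (-(qform H y / 2))
    = c / 2 * (qform B y * Real.exp (-(qform H y / 2))) := fun y => by ring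
  simp only [e, integral_const_mul, integral_qform_mul_exp h.posDef, pow_one] at this
  convert this using 2
  rw [gaussConst]; ring

lemma tendsto_partition (h : IsLaplacePotential U x₀ H) :
    Tendsto (fun t : ℝ => t ^ ((d : ℝ) / 2) * partition U t) atTop (𝓝 (gaussConst H)) := by
  have := h.tendsto_of_continuousAt (ψ := fun _ => 1) (by fun_prop) (by fun_prop) (t₀ := 1)
    (by simpa using h.integrable)
  simpa [partition] using this

lemma partition_anti (h : IsLaplacePotential U x₀ H) {s t : ℝ} (hs : 1 ≤ s) (hst : s ≤ t) :
    partition U t ≤ partition U s := by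
  refine integral_mono (h.integrable_exp (hs.trans hst)) (h.integrable_exp hs) fun x => ?_
  simp only [Real.exp_le_exp]
  nlinarith [h.nonneg x]

lemma exists_le_partition (h : IsLaplacePotential U x₀ H) :
    ∃ k > 0, ∀ t : ℝ, 1 ≤ t → k ≤ t ^ ((d : ℝ) / 2) * partition U t := by
  have hG := gaussConst_pos h.posDef
  obtain ⟨t₁, ht₁⟩ := eventually_atTop.1
    (h.tendsto_partition.eventually (eventually_gt_nhds (half_lt_self hG)))
  set t₂ := max t₁ 1
  refine ⟨min (gaussConst H / 2) (partition U t₂),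
    lt_min (half_pos hG) (h.partition_pos (le_max_right _ _)), fun t ht => ?_⟩
  rcases le_total t₁ t with h1 | h1
  · exact (min_le_left _ _).trans (ht₁ t h1).le
  · refine (min_le_right _ _).trans ((h.partition_anti ht (h1.trans (le_max_left _ _))).trans ?_)
    exact le_mul_of_one_le_left (h.partition_pos ht).le (Real.one_le_rpow ht (by positivity))

section Mean

variable {φ : E d → E q}

lemma integrable_exp_mul_norm_sub_sq (h : IsLaplacePotential U x₀ H) (hφ : Measurable φ)
    (hφ2 : Integrable fun x => Real.exp (-U x) * ‖φ x‖ ^ 2) (b : E q) {t : ℝ} (ht : 1 ≤ t) :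
    Integrable fun x => Real.exp (-t * U x) * ‖φ x - b‖ ^ 2 := by
  have hU := h.measurable
  refine integrable_exp_neg_mul_of_le h.measurable h.nonneg (t₀ := 1) (by fun_prop) ?_ ht
  refine ((hφ2.const_mul 2).add (h.integrable.const_mul (2 * ‖b‖ ^ 2))).mono' (by fun_prop)
    (Eventually.of_forall fun x => ?_)
  rw [Real.norm_of_nonneg (by positivity), Pi.add_apply, neg_one_mul]
  have h1 : ‖φ x - b‖ ^ 2 ≤ 2 * ‖φ x‖ ^ 2 + 2 * ‖b‖ ^ 2 := by
    have := norm_sub_le (φ x) b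
    nlinarith [sq_nonneg (‖φ x‖ - ‖b‖), norm_nonneg (φ x - b), norm_nonneg (φ x), norm_nonneg b]
  have := mul_le_mul_of_nonneg_left h1 (Real.exp_nonneg (-U x))
  linarith

lemma integrable_exp_smul_sub (h : IsLaplacePotential U x₀ H) (hφ : Measurable φ)
    (hφ2 : Integrable fun x => Real.exp (-U x) * ‖φ x‖ ^ 2) (b : E q) {t : ℝ} (ht : 1 ≤ t) :
    Integrable fun x => Real.exp (-t * U x) • (φ x - b) := by
  have hU := h.measurable
  refine ((h.integrable_exp_mul_norm_sub_sq hφ hφ2 b ht).add (h.integrable_exp ht)).mono'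
    (Measurable.aestronglyMeasurable (by fun_prop)) (Eventually.of_forall fun x => ?_)
  rw [norm_smul, Real.norm_of_nonneg (Real.exp_nonneg _), Pi.add_apply, ← mul_add_one]
  gcongr
  nlinarith [sq_nonneg (‖φ x - b‖ - 1), norm_nonneg (φ x - b)]

lemma integral_exp_smul_sub_gibbsMean (h : IsLaplacePotential U x₀ H) (hφ : Measurable φ)
    (hφ2 : Integrable fun x => Real.exp (-U x) * ‖φ x‖ ^ 2) {t : ℝ} (ht : 1 ≤ t) :
    ∫ x, Real.exp (-t * U x) • (φ x - gibbsMean U φ t) = 0 := by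
  have h1 : Integrable fun x => Real.exp (-t * U x) • φ x := by
    simpa using h.integrable_exp_smul_sub hφ hφ2 0 ht
  simp only [smul_sub]
  rw [integral_sub h1 ((h.integrable_exp ht).smul_const _), integral_smul_const, gibbsMean,
    ← partition, smul_smul, mul_inv_cancel₀ (h.partition_pos ht).ne', one_smul, sub_self]

lemma norm_gibbsMean_sub_sq_le (h : IsLaplacePotential U x₀ H) (hφ : Measurable φ)
    (hφ2 : Integrable fun x => Real.exp (-U x) * ‖φ x‖ ^ 2) (b : E q) {t : ℝ} (ht : 1 ≤ t) :
    partition U t * ‖gibbsMean U φ t - b‖ ^ 2 ≤ ∫ x, Real.exp (-t * U x) * ‖φ x - b‖ ^ 2 := by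
  set a := gibbsMean U φ t with ha
  have e : ∀ x, Real.exp (-t * U x) * ‖φ x - b‖ ^ 2 = Real.exp (-t * U x) * ‖φ x - a‖ ^ 2
      + 2 * inner ℝ (a - b) (Real.exp (-t * U x) • (φ x - a))
      + Real.exp (-t * U x) * ‖a - b‖ ^ 2 := by
    intro x
    have : φ x - b = (φ x - a) + (a - b) := by abel
    rw [this, norm_add_sq_real, inner_smul_right, real_inner_comm]
    ring
  have i1 := h.integrable_exp_mul_norm_sub_sq hφ hφ2 a ht
  have i2 := h.integrable_exp_smul_sub hφ hφ2 a ht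
  have i3 := (h.integrable_exp ht).mul_const (‖a - b‖ ^ 2)
  have i2' : Integrable fun x => 2 * inner ℝ (a - b) (Real.exp (-t * U x) • (φ x - a)) :=
    (i2.const_inner _).const_mul 2
  have i12 : Integrable fun x => Real.exp (-t * U x) * ‖φ x - a‖ ^ 2
      + 2 * inner ℝ (a - b) (Real.exp (-t * U x) • (φ x - a)) := i1.add i2'
  simp only [e]
  rw [integral_add i12 i3, integral_add i1 i2', integral_const_mul, integral_inner i2,
    h.integral_exp_smul_sub_gibbsMean hφ hφ2 ht, inner_zero_right, integral_mul_const, ← partition]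
  have : 0 ≤ ∫ x, Real.exp (-t * U x) * ‖φ x - a‖ ^ 2 :=
    integral_nonneg fun x => by positivity
  linarith

end Mean

end IsLaplacePotential

/-- The uniform bound `∫ exp (-2 α U) ‖φ - π_α(φ)‖² / g₀` on the conditional second moment of a
weighted centred sample. -/
noncomputable def varBound {d q : ℕ} (U : E d → ℝ) (φ : E d → E q) (g₀ : E d → ℝ) (α : ℝ) : ℝ :=
  ∫ x, Real.exp (-(2 * α) * U x) * (‖φ x - gibbsMean U φ α‖ ^ 2 / g₀ x)

lemma norm_sub_sq_le_two {V : Type*} [SeminormedAddCommGroup V] (a b : V) :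
    ‖a - b‖ ^ 2 ≤ 2 * ‖a‖ ^ 2 + 2 * ‖b‖ ^ 2 := by
  have := norm_sub_le a b
  nlinarith [sq_nonneg (‖a‖ - ‖b‖), norm_nonneg (a - b), norm_nonneg a, norm_nonneg b]

namespace IsLaplacePotential

variable {d q : ℕ} {U : E d → ℝ} {x₀ : E d} {H : Matrix (Fin d) (Fin d) ℝ}
  {φ : E d → E q} {g₀ : E d → ℝ} {c₀ : ℝ}

lemma exp_mul_div_le (h : IsLaplacePotential U x₀ H) (hg : ∀ x, 0 < g₀ x)
    (hc : ∀ x, Real.exp (-U x) ≤ c₀ * g₀ x) {r : ℝ} (hr : 0 ≤ r) {s t : ℝ} (hst : s + 1 ≤ t)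
    (x : E d) :
    Real.exp (-t * U x) * (r / g₀ x) ≤ c₀ * (Real.exp (-s * U x) * r) := by
  have h1 : Real.exp (-t * U x) ≤ Real.exp (-s * U x) * (c₀ * g₀ x) := by
    calc _ ≤ Real.exp (-s * U x) * Real.exp (-U x) := by
          rw [← Real.exp_add, Real.exp_le_exp]; nlinarith [h.nonneg x]
      _ ≤ _ := by gcongr; exact hc x
  calc _ ≤ Real.exp (-s * U x) * (c₀ * g₀ x) * (r / g₀ x) := by
        have := (hg x).le
        gcongr
    _ = _ := by have := (hg x).ne'; field_simp

lemma integrable_exp_mul_div (h : IsLaplacePotential U x₀ H) (hg : ∀ x, 0 < g₀ x)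
    (hgm : Measurable g₀) (hc : ∀ x, Real.exp (-U x) ≤ c₀ * g₀ x) {r : E d → ℝ}
    (hr : ∀ x, 0 ≤ r x) (hrm : Measurable r) {s t : ℝ} (hst : s + 1 ≤ t)
    (hint : Integrable fun x => Real.exp (-s * U x) * r x) :
    Integrable fun x => Real.exp (-t * U x) * (r x / g₀ x) := by
  have hU := h.measurable
  refine (hint.const_mul c₀).mono' (by fun_prop) (Eventually.of_forall fun x => ?_)
  rw [Real.norm_of_nonneg (mul_nonneg (Real.exp_nonneg _) (div_nonneg (hr x) (hg x).le))]
  exact h.exp_mul_div_le hg hc (hr x) hst x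

lemma isLittleO_norm_sub_sq (hg : ∀ x, 0 < g₀ x)
    (hgc : ContinuousAt g₀ x₀) {B : Matrix (Fin d) (Fin d) ℝ}
    (hψ : (fun x => ‖φ x - φ x₀‖ ^ 2 / g₀ x - qform B (x - x₀) / 2) =o[𝓝 x₀]
      fun x => ‖x - x₀‖ ^ 2) :
    (fun x => ‖φ x - φ x₀‖ ^ 2 - g₀ x₀ * (qform B (x - x₀) / 2)) =o[𝓝 x₀]
      fun x => ‖x - x₀‖ ^ 2 := by
  have hq : (fun x => qform B (x - x₀) / 2) =O[𝓝 x₀] fun x => ‖x - x₀‖ ^ 2 := by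
    refine IsBigO.of_bound ((∑ i, ∑ j, |B i j|) / 2) (Eventually.of_forall fun x => ?_)
    rw [Real.norm_eq_abs, abs_div, abs_two, Real.norm_of_nonneg (by positivity)]
    linarith [abs_qform_le B (x - x₀)]
  have hO : (fun x => ‖φ x - φ x₀‖ ^ 2 / g₀ x) =O[𝓝 x₀] fun x => ‖x - x₀‖ ^ 2 := by
    simpa using hψ.isBigO.add hq
  have hgo : (fun x => g₀ x - g₀ x₀) =o[𝓝 x₀] fun _ => (1 : ℝ) :=
    (isLittleO_one_iff ℝ).2 (tendsto_sub_nhds_zero_iff.2 hgc.tendsto)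
  have h1 := hgo.mul_isBigO hO
  simp only [one_mul] at h1
  refine (h1.add (hψ.const_mul_left (g₀ x₀))).congr_left fun x => ?_
  have := (hg x).ne'
  field_simp
  ring

lemma tendsto_integral_norm_sub_sq (h : IsLaplacePotential U x₀ H) (hφ : Measurable φ)
    (hφ2 : Integrable fun x => Real.exp (-U x) * ‖φ x‖ ^ 2) (hg : ∀ x, 0 < g₀ x)
    (hgc : ContinuousAt g₀ x₀) {B : Matrix (Fin d) (Fin d) ℝ}
    (hψ : (fun x => ‖φ x - φ x₀‖ ^ 2 / g₀ x - qform B (x - x₀) / 2) =o[𝓝 x₀]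
      fun x => ‖x - x₀‖ ^ 2) :
    Tendsto (fun t : ℝ => t ^ ((d : ℝ) / 2) * t * ∫ x, Real.exp (-t * U x) * ‖φ x - φ x₀‖ ^ 2)
      atTop (𝓝 (g₀ x₀ * ((H⁻¹ * B).trace / 2) * gaussConst H)) :=
  h.tendsto_of_isLittleO (by fun_prop) B (g₀ x₀) (isLittleO_norm_sub_sq hg hgc hψ)
    (t₀ := 1) (h.integrable_exp_mul_norm_sub_sq hφ hφ2 _ le_rfl)

lemma exists_norm_gibbsMean_sq_le (h : IsLaplacePotential U x₀ H) (hφ : Measurable φ)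
    (hφ2 : Integrable fun x => Real.exp (-U x) * ‖φ x‖ ^ 2) (hg : ∀ x, 0 < g₀ x)
    (hgc : ContinuousAt g₀ x₀) {B : Matrix (Fin d) (Fin d) ℝ}
    (hψ : (fun x => ‖φ x - φ x₀‖ ^ 2 / g₀ x - qform B (x - x₀) / 2) =o[𝓝 x₀]
      fun x => ‖x - x₀‖ ^ 2) :
    ∃ K > 0, ∀ t : ℝ, 1 ≤ t → ‖gibbsMean U φ t‖ ^ 2 ≤ K := by
  have hG := gaussConst_pos h.posDef
  have hJ := h.tendsto_integral_norm_sub_sq hφ hφ2 hg hgc hψ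
  have hlim : Tendsto (fun t : ℝ => (t ^ ((d : ℝ) / 2) * t *
      ∫ x, Real.exp (-t * U x) * ‖φ x - φ x₀‖ ^ 2) / (t ^ ((d : ℝ) / 2) * partition U t) * t⁻¹)
      atTop (𝓝 0) := by
    simpa using (hJ.div h.tendsto_partition hG.ne').mul tendsto_inv_atTop_zero
  obtain ⟨t₁, ht₁⟩ := eventually_atTop.1 (hlim.eventually (eventually_lt_nhds one_pos))
  set t₂ := max t₁ 1
  have hZ2 := h.partition_pos (le_max_right t₁ 1)
  set Φ := ∫ x, Real.exp (-U x) * ‖φ x‖ ^ 2 with hΦ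
  have hΦ0 : 0 ≤ Φ := integral_nonneg fun x => by positivity
  refine ⟨(2 + 2 * ‖φ x₀‖ ^ 2) + Φ / partition U t₂, by positivity, fun t ht => ?_⟩
  have hZ := h.partition_pos ht
  have ht0 : 0 < t := by linarith
  rcases le_total t₁ t with h1 | h1
  · have h2 := h.norm_gibbsMean_sub_sq_le hφ hφ2 (φ x₀) ht
    have h3 := ht₁ t h1
    have hp : 0 < t ^ ((d : ℝ) / 2) := by positivity
    have h4 : (∫ x, Real.exp (-t * U x) * ‖φ x - φ x₀‖ ^ 2) / partition U t < 1 := by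
      refine lt_of_eq_of_lt ?_ h3
      field_simp
    rw [div_lt_one hZ] at h4
    have h5 : ‖gibbsMean U φ t - φ x₀‖ ^ 2 ≤ 1 := by
      by_contra hcon
      push Not at hcon
      nlinarith
    have h6 := norm_sub_sq_le_two (gibbsMean U φ t - φ x₀) (-φ x₀)
    rw [sub_neg_eq_add, sub_add_cancel, norm_neg] at h6
    have : 0 ≤ Φ / partition U t₂ := by positivity
    linarith
  · have h2 := h.norm_gibbsMean_sub_sq_le hφ hφ2 0 ht
    simp only [sub_zero] at h2
    have h3 : ∫ x, Real.exp (-t * U x) * ‖φ x‖ ^ 2 ≤ Φ := by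
      have hi := h.integrable_exp_mul_norm_sub_sq hφ hφ2 0 ht
      simp only [sub_zero] at hi
      refine integral_mono hi hφ2 fun x => ?_
      simp only
      gcongr
      nlinarith [h.nonneg x]
    have h4 := h.partition_anti ht (h1.trans (le_max_left t₁ 1))
    have h5 : ‖gibbsMean U φ t‖ ^ 2 ≤ Φ / partition U t₂ := by
      rw [le_div_iff₀ hZ2, mul_comm]
      exact (mul_le_mul_of_nonneg_right h4 (by positivity)).trans (h2.trans h3)
    have : 0 ≤ 2 + 2 * ‖φ x₀‖ ^ 2 := by positivity
    linarith

lemma varBound_le (h : IsLaplacePotential U x₀ H) (hφ : Measurable φ)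
    (hφ2 : Integrable fun x => Real.exp (-U x) * ‖φ x‖ ^ 2) (hg : ∀ x, 0 < g₀ x)
    (hgm : Measurable g₀) (hc : ∀ x, Real.exp (-U x) ≤ c₀ * g₀ x) {t : ℝ} (ht : 1 ≤ t) :
    varBound U φ g₀ t ≤ 2 * (∫ x, Real.exp (-(2 * t) * U x) * (‖φ x - φ x₀‖ ^ 2 / g₀ x))
      + 2 * ‖gibbsMean U φ t - φ x₀‖ ^ 2 * ∫ x, Real.exp (-(2 * t) * U x) * (1 / g₀ x) := by
  have i0 : ∀ b, Integrable fun x => Real.exp (-(2 * t) * U x) * (‖φ x - b‖ ^ 2 / g₀ x) := fun b =>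
    h.integrable_exp_mul_div hg hgm hc (fun x => by positivity) (by fun_prop) (s := t) (by linarith)
      (h.integrable_exp_mul_norm_sub_sq hφ hφ2 b ht)
  have i1 : Integrable fun x => Real.exp (-(2 * t) * U x) * (1 / g₀ x) :=
    h.integrable_exp_mul_div hg hgm hc (fun x => by positivity) (by fun_prop) (s := t) (by linarith)
      (by simpa using h.integrable_exp ht)
  rw [← integral_const_mul, ← integral_const_mul, ← integral_add ((i0 _).const_mul _)
    (i1.const_mul _)]
  refine integral_mono (i0 _) (((i0 _).const_mul _).add (i1.const_mul _)) fun x => ?_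
  have h1 := norm_sub_sq_le_two (φ x - φ x₀) (gibbsMean U φ t - φ x₀)
  rw [sub_sub_sub_cancel_right] at h1
  have hpos : 0 ≤ Real.exp (-(2 * t) * U x) / g₀ x := div_nonneg (Real.exp_nonneg _) (hg x).le
  have := mul_le_mul_of_nonneg_left h1 hpos
  simp only
  calc _ = Real.exp (-(2 * t) * U x) / g₀ x * ‖φ x - gibbsMean U φ t‖ ^ 2 := by ring
    _ ≤ _ := this
    _ = _ := by ring

lemma varBound_nonneg (hg : ∀ x, 0 < g₀ x) (t : ℝ) : 0 ≤ varBound U φ g₀ t :=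
  integral_nonneg fun x => mul_nonneg (Real.exp_nonneg _) (div_nonneg (by positivity) (hg x).le)

/-- For large `α` the rescaled variance bound is below `2 Tr(H⁻¹ B)`. -/
lemma eventually_varBound_le (h : IsLaplacePotential U x₀ H) (hφ : Measurable φ)
    (hφ2 : Integrable fun x => Real.exp (-U x) * ‖φ x‖ ^ 2) (hg : ∀ x, 0 < g₀ x)
    (hgm : Measurable g₀) (hgc : ContinuousAt g₀ x₀) (hc : ∀ x, Real.exp (-U x) ≤ c₀ * g₀ x)
    {B : Matrix (Fin d) (Fin d) ℝ} (hT : 0 < (H⁻¹ * B).trace)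
    (hψ : (fun x => ‖φ x - φ x₀‖ ^ 2 / g₀ x - qform B (x - x₀) / 2) =o[𝓝 x₀]
      fun x => ‖x - x₀‖ ^ 2) :
    ∀ᶠ t : ℝ in atTop, varBound U φ g₀ t / partition U t ^ 2 ≤
      2 * (t ^ ((d : ℝ) / 2) / gaussConst H) * (2 : ℝ) ^ (-(d : ℝ) / 2) *
        ((H⁻¹ * B).trace / t) := by
  set T := (H⁻¹ * B).trace with hTdef
  have hG := gaussConst_pos h.posDef
  set G := gaussConst H with hGdef
  have hg0 := hg x₀
  have hdbl : Tendsto (fun t : ℝ => 2 * t) atTop atTop := tendsto_id.const_mul_atTop two_pos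
  have hJ := h.tendsto_integral_norm_sub_sq hφ hφ2 hg hgc hψ
  have hI := (h.tendsto_of_isLittleO (ψ := fun x => ‖φ x - φ x₀‖ ^ 2 / g₀ x) (by fun_prop) B 1
    (by simpa using hψ) (t₀ := 2)
    (h.integrable_exp_mul_div hg hgm hc (fun x => by positivity) (by fun_prop) (s := 1)
      (by norm_num) (h.integrable_exp_mul_norm_sub_sq hφ hφ2 _ le_rfl))).comp hdbl
  have hV := (h.tendsto_of_continuousAt (ψ := fun x => 1 / g₀ x) (by fun_prop)
    (by simp only [one_div]; exact hgc.inv₀ hg0.ne') (t₀ := 2)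
    (h.integrable_exp_mul_div hg hgm hc (fun x => by positivity) (by fun_prop) (s := 1)
      (by norm_num) (by simpa using h.integrable))).comp hdbl
  have hZ := h.tendsto_partition
  simp only [Function.comp_def] at hI hV
  rw [← hTdef, ← hGdef] at hJ hI
  rw [← hGdef] at hV hZ
  have hW := (hI.add (((hJ.div hZ hG.ne').mul hV).const_mul 2)).mul
    ((hZ.pow 2).inv₀ (by positivity)) |>.mul_const G
  have hlim : (1 * (T / 2) * G + 2 * (g₀ x₀ * (T / 2) * G / G * (1 / g₀ x₀ * G))) * (G ^ 2)⁻¹ * G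
      = 3 / 2 * T := by
    field_simp
    ring
  rw [hlim] at hW
  simp only [Pi.div_apply] at hW
  filter_upwards [hW.eventually (eventually_lt_nhds (show 3 / 2 * T < 2 * T by linarith)),
    eventually_ge_atTop 1] with t h1 ht
  have ht0 : 0 < t := by linarith
  have hZt := h.partition_pos ht
  have hvb := h.varBound_le hφ hφ2 hg hgm hc ht
  have hmean := h.norm_gibbsMean_sub_sq_le hφ hφ2 (φ x₀) ht
  set Z := partition U t
  set J := ∫ x, Real.exp (-t * U x) * ‖φ x - φ x₀‖ ^ 2
  set I := ∫ x, Real.exp (-(2 * t) * U x) * (‖φ x - φ x₀‖ ^ 2 / g₀ x)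
  have hV0 : 0 ≤ ∫ x, Real.exp (-(2 * t) * U x) * (1 / g₀ x) :=
    integral_nonneg fun x => mul_nonneg (Real.exp_nonneg _) (div_nonneg zero_le_one (hg x).le)
  set V := ∫ x, Real.exp (-(2 * t) * U x) * (1 / g₀ x)
  set A := varBound U φ g₀ t
  have hp : 0 < t ^ ((d : ℝ) / 2) := by positivity
  have hp2 : 0 < (2 : ℝ) ^ ((d : ℝ) / 2) := by positivity
  have hmul : (2 * t) ^ ((d : ℝ) / 2) = 2 ^ ((d : ℝ) / 2) * t ^ ((d : ℝ) / 2) :=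
    Real.mul_rpow (by norm_num) ht0.le
  have hneg : (2 : ℝ) ^ (-(d : ℝ) / 2) = (2 ^ ((d : ℝ) / 2))⁻¹ := by
    rw [neg_div, Real.rpow_neg (by norm_num)]
  rw [hmul] at h1
  rw [hneg]
  set s := t ^ ((d : ℝ) / 2)
  set e := (2 : ℝ) ^ ((d : ℝ) / 2)
  have hA : A ≤ 2 * I + 2 * (J / Z) * V := by
    refine hvb.trans ?_
    gcongr
    rw [le_div_iff₀ hZt, mul_comm]
    exact hmean
  have hkey : (2 * I + 2 * (J / Z) * V) / Z ^ 2 * (t * e * G / s) ≤ 2 * T := by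
    refine le_trans (le_of_eq ?_) h1.le
    field_simp
  have h2 : A / Z ^ 2 * (t * e * G / s) ≤ 2 * T := by
    refine le_trans ?_ hkey
    gcongr
  have h3 := (le_div_iff₀ (show 0 < t * e * G / s by positivity)).2 h2
  refine h3.trans (le_of_eq ?_)
  field_simp

/-- The rescaled variance bound for all `α ≥ 2`. -/
lemma exists_varBound_le (h : IsLaplacePotential U x₀ H) (hφ : Measurable φ)
    (hφ2 : Integrable fun x => Real.exp (-U x) * ‖φ x‖ ^ 2) (hg : ∀ x, 0 < g₀ x)
    (hgm : Measurable g₀) (hgc : ContinuousAt g₀ x₀) (hc0 : 0 < c₀)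
    (hc : ∀ x, Real.exp (-U x) ≤ c₀ * g₀ x)
    {B : Matrix (Fin d) (Fin d) ℝ} (hT : 0 < (H⁻¹ * B).trace)
    (hψ : (fun x => ‖φ x - φ x₀‖ ^ 2 / g₀ x - qform B (x - x₀) / 2) =o[𝓝 x₀]
      fun x => ‖x - x₀‖ ^ 2) :
    ∃ C > 0, ∀ t : ℝ, 2 ≤ t → varBound U φ g₀ t / partition U t ^ 2 ≤
      2 * (t ^ ((d : ℝ) / 2) / gaussConst H) * (2 : ℝ) ^ (-(d : ℝ) / 2) *
        ((H⁻¹ * B).trace / t) * (1 + C / t) := by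
  obtain ⟨K, hK, hKm⟩ := h.exists_norm_gibbsMean_sq_le hφ hφ2 hg hgc hψ
  obtain ⟨t₁, ht₁⟩ := eventually_atTop.1 (h.eventually_varBound_le hφ hφ2 hg hgm hgc hc hT hψ)
  set T := (H⁻¹ * B).trace with hTdef
  have hG := gaussConst_pos h.posDef
  set G := gaussConst H with hGdef
  set t₂ := max t₁ 1
  have ht₂ : 1 ≤ t₂ := le_max_right _ _
  have hZ2 := h.partition_pos ht₂
  set Φ := ∫ x, Real.exp (-U x) * ‖φ x‖ ^ 2 with hΦ
  have hΦ0 : 0 ≤ Φ := integral_nonneg fun x => by positivity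
  have hZ1 := h.partition_pos le_rfl
  set A₁ := c₀ * (2 * Φ + 2 * K * partition U 1) with hA₁
  have hA1 : 0 < A₁ := by positivity
  set e := (2 : ℝ) ^ (-(d : ℝ) / 2)
  have he : 0 < e := by positivity
  refine ⟨A₁ / partition U t₂ ^ 2 * t₂ ^ 2 * G / (2 * e * T), by positivity, fun t ht => ?_⟩
  have ht0 : 0 < t := by linarith
  have hpow : 1 ≤ t ^ ((d : ℝ) / 2) := Real.one_le_rpow (by linarith) (by positivity)
  rcases le_total t₁ t with h1 | h1
  · refine (ht₁ t h1).trans (le_mul_of_one_le_right (by positivity) ?_)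
    rw [le_add_iff_nonneg_right]
    positivity
  · have htt : t ≤ t₂ := h1.trans (le_max_left _ _)
    have hA : varBound U φ g₀ t ≤ A₁ := by
      have i0 : Integrable fun x =>
          Real.exp (-(2 * t) * U x) * (‖φ x - gibbsMean U φ t‖ ^ 2 / g₀ x) :=
        h.integrable_exp_mul_div hg hgm hc (fun x => by positivity) (by fun_prop) (s := t)
          (by linarith) (h.integrable_exp_mul_norm_sub_sq hφ hφ2 _ (by linarith))
      have i1 : Integrable fun x => c₀ * (2 * (Real.exp (-U x) * ‖φ x‖ ^ 2) +
          2 * K * Real.exp (-1 * U x)) :=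
        ((hφ2.const_mul 2).add ((h.integrable_exp le_rfl).const_mul (2 * K))).const_mul c₀
      calc varBound U φ g₀ t ≤ ∫ x, c₀ * (2 * (Real.exp (-U x) * ‖φ x‖ ^ 2) +
          2 * K * Real.exp (-1 * U x)) := by
            refine integral_mono i0 i1 fun x => ?_
            refine (h.exp_mul_div_le hg hc (by positivity) (s := 1) (by linarith) x).trans ?_
            have h2 := norm_sub_sq_le_two (φ x) (gibbsMean U φ t)
            have h3 := hKm t (by linarith)
            have h4 : ‖φ x - gibbsMean U φ t‖ ^ 2 ≤ 2 * ‖φ x‖ ^ 2 + 2 * K := by linarith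
            have h5 := mul_le_mul_of_nonneg_left h4 (Real.exp_nonneg (-U x))
            simp only [neg_one_mul]
            refine mul_le_mul_of_nonneg_left ?_ hc0.le
            linarith
        _ = A₁ := by
            rw [integral_const_mul, integral_add (hφ2.const_mul 2)
              ((h.integrable_exp le_rfl).const_mul (2 * K)), integral_const_mul, integral_const_mul,
              hA₁, partition]
    have hZ := h.partition_anti (by linarith : 1 ≤ t) htt
    calc varBound U φ g₀ t / partition U t ^ 2 ≤ A₁ / partition U t₂ ^ 2 := by gcongr
      _ = 2 * (1 / G) * e * (T / t₂) *
          ((A₁ / partition U t₂ ^ 2 * t₂ ^ 2 * G / (2 * e * T)) / t₂) := by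
          field_simp
      _ ≤ 2 * (t ^ ((d : ℝ) / 2) / G) * e * (T / t) *
          ((A₁ / partition U t₂ ^ 2 * t₂ ^ 2 * G / (2 * e * T)) / t) := by gcongr
      _ ≤ _ := by
          gcongr
          linarith

end IsLaplacePotential

section Disintegration

variable {d q : ℕ} {Ω Ω₁ : Type*} [mΩ : MeasurableSpace Ω] [mΩ₁ : MeasurableSpace Ω₁]

/-- `X` has conditional density `ρ (T ω)` given the information `T`, in the sense of integrals of
nonnegative functions. -/
def HasCondDensity (μ : Measure Ω) (T : Ω → Ω₁) (X : Ω → E d) (ρ : Ω₁ → E d → ℝ) : Prop :=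
  ∀ h : Ω₁ × E d → ℝ≥0∞, Measurable h →
    ∫⁻ ω, h (T ω, X ω) ∂μ = ∫⁻ ω, (∫⁻ x, h (T ω, x) * ENNReal.ofReal (ρ (T ω) x)) ∂μ

lemma HasCondDensity.of_rectangles {μ : Measure Ω} [IsProbabilityMeasure μ] {T : Ω → Ω₁}
    (hT : Measurable T) {X : Ω → E d} (hX : Measurable X) {ρ : Ω₁ → E d → ℝ}
    (hρ : Measurable (Function.uncurry ρ))
    (hrect : ∀ A : Set Ω₁, MeasurableSet A → ∀ s : Set (E d), MeasurableSet s →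
      μ (T ⁻¹' A ∩ X ⁻¹' s) =
        ∫⁻ ω in T ⁻¹' A, (∫⁻ x in s, ENNReal.ofReal (ρ (T ω) x)) ∂μ) :
    HasCondDensity μ T X ρ := by
  have hTX : Measurable fun ω => (T ω, X ω) := hT.prodMk hX
  have hρ' : Measurable fun z : Ω₁ × E d => ENNReal.ofReal (ρ z.1 z.2) := hρ.ennreal_ofReal
  have : IsProbabilityMeasure (μ.map T) := Measure.isProbabilityMeasure_map hT.aemeasurable
  have heq : μ.map (fun ω => (T ω, X ω)) =
      ((μ.map T).prod volume).withDensity fun z => ENNReal.ofReal (ρ z.1 z.2) := by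
    have : IsProbabilityMeasure (μ.map fun ω => (T ω, X ω)) :=
      Measure.isProbabilityMeasure_map hTX.aemeasurable
    refine Measure.ext_prod fun {A s} hA hs => ?_
    rw [Measure.map_apply hTX (hA.prod hs), withDensity_apply _ (hA.prod hs),
      ← Measure.prod_restrict, lintegral_prod _ hρ'.aemeasurable, Measure.restrict_map hT hA,
      lintegral_map (Measurable.lintegral_prod_right' hρ') hT, ← hrect A hA s hs]
    rfl
  intro h hh
  have h1 : ∫⁻ ω, h (T ω, X ω) ∂μ = ∫⁻ z, h z ∂(μ.map fun ω => (T ω, X ω)) :=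
    (lintegral_map hh hTX).symm
  rw [h1, heq, lintegral_withDensity_eq_lintegral_mul _ hρ' hh,
    lintegral_prod _ (hρ'.mul hh).aemeasurable,
    lintegral_map (Measurable.lintegral_prod_right' (hρ'.mul hh)) hT]
  simp only [Pi.mul_apply, mul_comm]

end Disintegration

/-- Adaptive sampling, with the information available before each draw described by a sequence of
σ-algebras such that every sample, the first one included, has a conditional density. -/
structure IsSequentialSampling {d : ℕ} (𝒬 : Set (E d → ℝ)) {Ω : Type*} {mΩ : MeasurableSpace Ω}
    (μ : Measure Ω) (G : ℕ → MeasurableSpace Ω) (X : ℕ → Ω → E d) (p : ℕ → Ω → E d → ℝ) :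
    Prop where
  le : ∀ i, G i ≤ mΩ
  mono : ∀ i, G i ≤ G (i + 1)
  adapted : ∀ i, Measurable[G (i + 1)] (X (i + 1))
  density_measurable : ∀ i,
    @Measurable (Ω × E d) ℝ ((G i).prod inferInstance) _ (Function.uncurry (p i))
  density_mem : ∀ i, ∀ᵐ ω ∂μ, p i ω ∈ 𝒬
  cond_density : ∀ i, @HasCondDensity d Ω Ω mΩ (G i) μ id (X (i + 1)) (p i)

lemma IsProbDensity.integrable {d : ℕ} {p : E d → ℝ} (hp : IsProbDensity p) : Integrable p := by
  obtain ⟨hm, h0, h1⟩ := hp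
  rw [← lintegral_ofReal_ne_top_iff_integrable hm.aestronglyMeasurable (Eventually.of_forall h0), h1]
  exact ENNReal.one_ne_top

lemma IsProbDensity.integral_eq_one {d : ℕ} {p : E d → ℝ} (hp : IsProbDensity p) :
    ∫ x, p x = 1 := by
  obtain ⟨hm, h0, h1⟩ := hp
  rw [integral_eq_lintegral_of_nonneg_ae (Eventually.of_forall h0) hm.aestronglyMeasurable, h1]
  rfl

lemma IsProbDensity.ofReal_setIntegral {d : ℕ} {p : E d → ℝ} (hp : IsProbDensity p)
    (s : Set (E d)) :
    ENNReal.ofReal (∫ x in s, p x) = ∫⁻ x in s, ENNReal.ofReal (p x) :=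
  ofReal_integral_eq_lintegral_ofReal hp.integrable.integrableOn (Eventually.of_forall hp.2.1)

theorem IsAdaptiveSampling.exists_isSequentialSampling {d : ℕ} {𝒬 : Set (E d → ℝ)} {Ω : Type*}
    {mΩ : MeasurableSpace Ω} {μ : Measure Ω} [IsProbabilityMeasure μ] {F : Filtration ℕ mΩ}
    {X : ℕ → Ω → E d} {p : ℕ → Ω → E d → ℝ} (h𝒬 : ∀ p ∈ 𝒬, IsProbDensity p)
    (h : IsAdaptiveSampling 𝒬 μ F X p) :
    ∃ G : ℕ → MeasurableSpace Ω, IsSequentialSampling 𝒬 μ G X p := by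
  obtain ⟨q₀, hq₀, hp0, hlaw⟩ := h.init
  have hX : ∀ i, Measurable (X (i + 1)) := fun i =>
    (h.adapted (i + 1) (by omega)).mono (F.le _) le_rfl
  let G : ℕ → MeasurableSpace Ω := fun i => if i = 0 then ⊥ else F i
  have hG0 : G 0 = ⊥ := rfl
  have hGs : ∀ i, G (i + 1) = F (i + 1) := fun i => rfl
  have hle : ∀ i, G i ≤ mΩ := fun i => by
    cases i with
    | zero => exact bot_le
    | succ i => exact F.le _
  have hmeas : ∀ i,
      @Measurable (Ω × E d) ℝ ((G i).prod inferInstance) _ (Function.uncurry (p i)) := by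
    intro i
    cases i with
    | zero =>
      have : Function.uncurry (p 0) = q₀ ∘ Prod.snd := by
        ext ⟨ω, x⟩; simp [hp0]
      rw [this]
      exact (h𝒬 _ hq₀).1.comp (@measurable_snd Ω (E d) (G 0) _)
    | succ i => exact h.density_measurable (i + 1) (by omega)
  have hmem : ∀ i, ∀ᵐ ω ∂μ, p i ω ∈ 𝒬 := by
    intro i
    cases i with
    | zero => exact Eventually.of_forall fun ω => by rw [hp0]; exact hq₀
    | succ i => exact h.density_mem (i + 1) (by omega)
  refine ⟨G, hle, fun i => ?_, fun i => h.adapted (i + 1) (by omega), hmeas, hmem, fun i => ?_⟩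
  · cases i with
    | zero => exact bot_le
    | succ i => exact F.mono (by omega)
  · refine @HasCondDensity.of_rectangles d Ω Ω mΩ (G i) μ _ id (measurable_id'' (hle i)) _ (hX i) _
      (hmeas i) fun A hA s hs => ?_
    simp only [Set.preimage_id, id]
    cases i with
    | zero =>
      have hlaw' : μ (X 1 ⁻¹' s) = ∫⁻ x in s, ENNReal.ofReal (q₀ x) := by
        rw [← Measure.map_apply (hX 0) hs, hlaw, withDensity_apply _ hs]
      simp only [hp0, ← hlaw', lintegral_const, Measure.restrict_apply MeasurableSet.univ,
        Set.univ_inter, zero_add]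
      rcases MeasurableSpace.measurableSet_bot_iff.1 hA with rfl | rfl <;> simp
    | succ i =>
      have hA' : MeasurableSet A := F.le _ _ hA
      have hXs : MeasurableSet (X (i + 1 + 1) ⁻¹' s) := hX (i + 1) hs
      have hind : Integrable ((X (i + 1 + 1) ⁻¹' s).indicator (fun _ => (1 : ℝ))) μ :=
        (integrable_const 1).indicator hXs
      have hce := h.cond_density (i + 1) (by omega) s hs
      have h1 : ∫ ω in A, (X (i + 1 + 1) ⁻¹' s).indicator (fun _ => (1 : ℝ)) ω ∂μ
          = ∫ ω in A, (∫ x in s, p (i + 1) ω x) ∂μ := by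
        rw [← setIntegral_condExp (F.le (i + 1)) hind hA]
        exact setIntegral_congr_ae hA' (hce.mono fun ω hω _ => hω)
      have hint : Integrable (fun ω => ∫ x in s, p (i + 1) ω x) μ :=
        (integrable_congr hce).1 integrable_condExp
      have h2 : ENNReal.ofReal (∫ ω in A, (∫ x in s, p (i + 1) ω x) ∂μ)
          = ∫⁻ ω in A, (∫⁻ x in s, ENNReal.ofReal (p (i + 1) ω x)) ∂μ := by
        rw [ofReal_integral_eq_lintegral_ofReal hint.integrableOn]
        · refine lintegral_congr_ae (ae_restrict_of_ae ((hmem (i + 1)).mono fun ω hω => ?_))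
          exact (h𝒬 _ hω).ofReal_setIntegral s
        · refine ae_restrict_of_ae ((hmem (i + 1)).mono fun ω hω => ?_)
          exact integral_nonneg (h𝒬 _ hω).2.1
      rw [← h2, ← h1, integral_indicator hXs]
      simp [Measure.restrict_apply hXs, Set.inter_comm]

/-- The class of densities bounded below by `g₀` under which `‖φ‖⁴` has integral at most `M`. -/
structure IsPolicy {d q : ℕ} (g₀ : E d → ℝ) (φ : E d → E q) (M : ℝ) (p : E d → ℝ) : Prop where
  isProbDensity : IsProbDensity p
  le : ∀ x, g₀ x ≤ p x
  integrable : Integrable fun y => ‖φ y‖ ^ 4 * p y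
  integral_le : ∫ y, ‖φ y‖ ^ 4 * p y ≤ M

lemma exp_neg_le_quadratic {t : ℝ} (ht : 0 ≤ t) : Real.exp (-t) ≤ 1 - t + t ^ 2 / 2 := by
  have h := Real.quadratic_le_exp_of_nonneg ht
  have h1 : (0 : ℝ) < 1 + t + t ^ 2 / 2 := by positivity
  rw [Real.exp_neg]
  calc (Real.exp t)⁻¹ ≤ (1 + t + t ^ 2 / 2)⁻¹ := inv_anti₀ h1 h
    _ ≤ 1 - t + t ^ 2 / 2 := by
      rw [inv_le_iff_one_le_mul₀ h1]
      nlinarith [sq_nonneg (t ^ 2)]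

section OneStep

variable {d q : ℕ} {U : E d → ℝ} {x₀ : E d} {H : Matrix (Fin d) (Fin d) ℝ}
  {φ : E d → E q} {g₀ : E d → ℝ} {c₀ M : ℝ} {p : E d → ℝ}

lemma lintegral_ofReal_mul_ofReal_le {F p R : E d → ℝ} (hp : ∀ x, 0 ≤ p x)
    (hF : ∀ x, 0 ≤ F x) (hR : Integrable R) (hle : ∀ x, F x * p x ≤ R x) :
    ∫⁻ x, ENNReal.ofReal (F x) * ENNReal.ofReal (p x) ≤ ENNReal.ofReal (∫ x, R x) := by
  rw [ofReal_integral_eq_lintegral_ofReal hR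
    (Eventually.of_forall fun x => (mul_nonneg (hF x) (hp x)).trans (hle x))]
  refine lintegral_mono fun x => ?_
  rw [← ENNReal.ofReal_mul (hF x)]
  exact ENNReal.ofReal_le_ofReal (hle x)

lemma lintegral_exp_neg_weight_le (h : IsLaplacePotential U x₀ H) (hg : ∀ x, 0 < g₀ x)
    (hc : ∀ x, Real.exp (-U x) ≤ c₀ * g₀ x) (hc0 : 0 < c₀) (hp : IsPolicy g₀ φ M p)
    {α : ℝ} (hα : 1 ≤ α) {s : ℝ} (hs : 0 ≤ s) :
    ∫⁻ x, ENNReal.ofReal (Real.exp (-s * (Real.exp (-α * U x) / p x))) * ENNReal.ofReal (p x) ≤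
      ENNReal.ofReal (Real.exp (-(s - s ^ 2 * c₀ / 2) * partition U α)) := by
  have hpp : ∀ x, 0 < p x := fun x => (hg x).trans_le (hp.le x)
  have i1 := hp.isProbDensity.integrable
  have i2 := (h.integrable_exp hα).const_mul (s - s ^ 2 * c₀ / 2)
  refine (lintegral_ofReal_mul_ofReal_le
    (R := fun x => p x - (s - s ^ 2 * c₀ / 2) * Real.exp (-α * U x))
    (fun x => (hpp x).le) (fun x => Real.exp_nonneg _) (i1.sub i2) fun x => ?_).trans
    (ENNReal.ofReal_le_ofReal ?_)
  · have hpx := hpp x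
    set w := Real.exp (-α * U x) / p x with hw
    have hw0 : 0 ≤ w := by positivity
    have hwc : w ≤ c₀ := by
      rw [hw, div_le_iff₀ hpx]
      calc Real.exp (-α * U x) ≤ Real.exp (-U x) := by
            rw [Real.exp_le_exp]; nlinarith [h.nonneg x]
        _ ≤ c₀ * g₀ x := hc x
        _ ≤ _ := by gcongr; exact hp.le x
    have hwp : Real.exp (-α * U x) = w * p x := by rw [hw]; field_simp
    rw [hwp]
    have h1 := exp_neg_le_quadratic (mul_nonneg hs hw0)
    rw [neg_mul]
    have h2 : s ^ 2 * (w * w) ≤ s ^ 2 * (c₀ * w) := by gcongr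
    calc Real.exp (-(s * w)) * p x ≤ (1 - s * w + s ^ 2 * (c₀ * w) / 2) * p x := by
          gcongr
          nlinarith
      _ = _ := by ring
  · rw [integral_sub i1 i2, hp.isProbDensity.integral_eq_one, integral_const_mul, ← partition]
    have := Real.add_one_le_exp (-(s - s ^ 2 * c₀ / 2) * partition U α)
    linarith

lemma lintegral_norm_add_weight_smul_sq_le (h : IsLaplacePotential U x₀ H) (hφ : Measurable φ)
    (hφ2 : Integrable fun x => Real.exp (-U x) * ‖φ x‖ ^ 2) (hg : ∀ x, 0 < g₀ x)
    (hgm : Measurable g₀) (hc : ∀ x, Real.exp (-U x) ≤ c₀ * g₀ x) (hp : IsPolicy g₀ φ M p)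
    {α : ℝ} (hα : 1 ≤ α) (v : E q) :
    ∫⁻ x, ENNReal.ofReal (‖v + (Real.exp (-α * U x) / p x) • (φ x - gibbsMean U φ α)‖ ^ 2) *
      ENNReal.ofReal (p x) ≤ ENNReal.ofReal (‖v‖ ^ 2) + ENNReal.ofReal (varBound U φ g₀ α) := by
  have hpp : ∀ x, 0 < p x := fun x => (hg x).trans_le (hp.le x)
  have i1 := hp.isProbDensity.integrable.const_mul (‖v‖ ^ 2)
  have i2 := h.integrable_exp_smul_sub hφ hφ2 (gibbsMean U φ α) hα
  have i2' : Integrable fun x =>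
      2 * inner ℝ v (Real.exp (-α * U x) • (φ x - gibbsMean U φ α)) :=
    (i2.const_inner v).const_mul 2
  have i3 : Integrable fun x =>
      Real.exp (-(2 * α) * U x) * (‖φ x - gibbsMean U φ α‖ ^ 2 / g₀ x) :=
    h.integrable_exp_mul_div hg hgm hc (fun x => by positivity) (by fun_prop) (s := α)
      (by linarith) (h.integrable_exp_mul_norm_sub_sq hφ hφ2 _ hα)
  have i12 : Integrable fun x => ‖v‖ ^ 2 * p x +
      2 * inner ℝ v (Real.exp (-α * U x) • (φ x - gibbsMean U φ α)) := i1.add i2'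
  refine (lintegral_ofReal_mul_ofReal_le (fun x => (hpp x).le) (fun x => by positivity)
    (i12.add i3) fun x => ?_).trans (le_of_eq ?_)
  · have hpx := hpp x
    simp only [Pi.add_apply]
    rw [norm_add_sq_real, norm_smul, inner_smul_right, inner_smul_right,
      Real.norm_of_nonneg (by positivity), add_mul, add_mul]
    refine add_le_add (add_le_add le_rfl (le_of_eq ?_)) ?_
    · field_simp
    · have e : Real.exp (-(2 * α) * U x) = Real.exp (-α * U x) ^ 2 := by
        rw [← Real.exp_nat_mul]; congr 1; push_cast; ring
      rw [e]
      calc _ = Real.exp (-α * U x) ^ 2 * (‖φ x - gibbsMean U φ α‖ ^ 2 / p x) := by field_simp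
        _ ≤ _ := by
          gcongr
          · exact hg x
          · exact hp.le x
  · simp only [Pi.add_apply]
    rw [← ENNReal.ofReal_add (by positivity) (IsLaplacePotential.varBound_nonneg hg α),
      integral_add i12 i3, integral_add i1 i2', integral_const_mul, integral_const_mul,
      integral_inner i2, h.integral_exp_smul_sub_gibbsMean hφ hφ2 hα, inner_zero_right,
      hp.isProbDensity.integral_eq_one, varBound]
    simp

end OneStep

section Sampling

variable {d q : ℕ} {U : E d → ℝ} {x₀ : E d} {H : Matrix (Fin d) (Fin d) ℝ}
  {φ : E d → E q} {g₀ : E d → ℝ} {c₀ M : ℝ}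

lemma HasCondDensity.lintegral_exp_step {Ω Ω₁ : Type*} [MeasurableSpace Ω] [MeasurableSpace Ω₁]
    {μ : Measure Ω} {T : Ω → Ω₁} {X : Ω → E d} {ρ : Ω₁ → E d → ℝ} (hX : HasCondDensity μ T X ρ)
    (hρ : Measurable (Function.uncurry ρ)) (hmem : ∀ᵐ ω ∂μ, IsPolicy g₀ φ M (ρ (T ω)))
    (h : IsLaplacePotential U x₀ H) (hg : ∀ x, 0 < g₀ x)
    (hc : ∀ x, Real.exp (-U x) ≤ c₀ * g₀ x) (hc0 : 0 < c₀) {α : ℝ} (hα : 1 ≤ α) {s : ℝ}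
    (hs : 0 ≤ s) {S : Ω₁ → ℝ} (hS : Measurable S) (hT : Measurable T) :
    ∫⁻ ω, ENNReal.ofReal (Real.exp (-s * (S (T ω) + Real.exp (-α * U (X ω)) / ρ (T ω) (X ω)))) ∂μ
      ≤ (∫⁻ ω, ENNReal.ofReal (Real.exp (-s * S (T ω))) ∂μ) *
        ENNReal.ofReal (Real.exp (-(s - s ^ 2 * c₀ / 2) * partition U α)) := by
  have hU := h.measurable
  have hρ' : Measurable fun z : Ω₁ × E d => ρ z.1 z.2 := hρ
  have hm : Measurable fun z : Ω₁ × E d => ENNReal.ofReal (Real.exp (-s * S z.1)) *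
      ENNReal.ofReal (Real.exp (-s * (Real.exp (-α * U z.2) / ρ z.1 z.2))) := by fun_prop
  have h1 := hX _ hm
  simp only at h1
  have e : ∀ a b : ℝ, ENNReal.ofReal (Real.exp (-s * (a + b))) =
      ENNReal.ofReal (Real.exp (-s * a)) * ENNReal.ofReal (Real.exp (-s * b)) := fun a b => by
    rw [← ENNReal.ofReal_mul (Real.exp_nonneg _), ← Real.exp_add, mul_add]
  simp only [e]
  rw [h1, ← lintegral_mul_const _ (by fun_prop)]
  refine lintegral_mono_ae (hmem.mono fun ω hω => ?_)
  simp only [mul_assoc]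
  rw [lintegral_const_mul' _ _ ENNReal.ofReal_ne_top]
  gcongr
  exact lintegral_exp_neg_weight_le h hg hc hc0 hω hα hs

lemma HasCondDensity.lintegral_norm_sq_step {Ω Ω₁ : Type*} [MeasurableSpace Ω] [MeasurableSpace Ω₁]
    {μ : Measure Ω} [IsProbabilityMeasure μ] {T : Ω → Ω₁} {X : Ω → E d} {ρ : Ω₁ → E d → ℝ}
    (hX : HasCondDensity μ T X ρ)
    (hρ : Measurable (Function.uncurry ρ)) (hmem : ∀ᵐ ω ∂μ, IsPolicy g₀ φ M (ρ (T ω)))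
    (h : IsLaplacePotential U x₀ H) (hφ : Measurable φ)
    (hφ2 : Integrable fun x => Real.exp (-U x) * ‖φ x‖ ^ 2) (hg : ∀ x, 0 < g₀ x)
    (hgm : Measurable g₀)
    (hc : ∀ x, Real.exp (-U x) ≤ c₀ * g₀ x) {α : ℝ} (hα : 1 ≤ α)
    {S : Ω₁ → E q} (hS : Measurable S) :
    ∫⁻ ω, ENNReal.ofReal (‖S (T ω) + (Real.exp (-α * U (X ω)) / ρ (T ω) (X ω)) •
        (φ (X ω) - gibbsMean U φ α)‖ ^ 2) ∂μ
      ≤ (∫⁻ ω, ENNReal.ofReal (‖S (T ω)‖ ^ 2) ∂μ) + ENNReal.ofReal (varBound U φ g₀ α) := by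
  have hU := h.measurable
  have hρ' : Measurable fun z : Ω₁ × E d => ρ z.1 z.2 := hρ
  have hm : Measurable fun z : Ω₁ × E d => ENNReal.ofReal (‖S z.1 +
      (Real.exp (-α * U z.2) / ρ z.1 z.2) • (φ z.2 - gibbsMean U φ α)‖ ^ 2) := by
    fun_prop
  have h1 := hX _ hm
  simp only at h1
  rw [h1]
  refine (lintegral_mono_ae (hmem.mono fun ω hω =>
    lintegral_norm_add_weight_smul_sq_le h hφ hφ2 hg hgm hc hω hα (S (T ω)))).trans ?_
  rw [lintegral_add_right _ measurable_const]
  simp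

namespace IsSequentialSampling

variable {𝒬 : Set (E d → ℝ)} {Ω : Type*} {mΩ : MeasurableSpace Ω}
  {μ : Measure Ω} {G : ℕ → MeasurableSpace Ω} {X : ℕ → Ω → E d} {p : ℕ → Ω → E d → ℝ}

lemma measurable_weight (hs : IsSequentialSampling 𝒬 μ G X p) (hU : Measurable U) (α : ℝ) (i : ℕ) :
    Measurable[G (i + 1)] (weight U α X p i) := by
  have h1 : @Measurable Ω (Ω × E d) (G (i + 1)) ((G i).prod inferInstance)
      fun ω => (ω, X (i + 1) ω) :=
    @Measurable.prodMk Ω (G (i + 1)) Ω (E d) (G i) _ id (X (i + 1))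
      (measurable_id'' (hs.mono i)) (hs.adapted i)
  have h2 : Measurable[G (i + 1)] fun ω => p i ω (X (i + 1) ω) :=
    (hs.density_measurable i).comp h1
  have h3 : Measurable[G (i + 1)] fun ω => Real.exp (-α * U (X (i + 1) ω)) :=
    (by fun_prop : Measurable fun x => Real.exp (-α * U x)).comp (hs.adapted i)
  exact h3.div h2

lemma le_of_le (hs : IsSequentialSampling 𝒬 μ G X p) {i j : ℕ} (hij : i ≤ j) : G i ≤ G j :=
  monotone_nat_of_le_succ hs.mono hij

lemma measurable_sum_weight (hs : IsSequentialSampling 𝒬 μ G X p) (hU : Measurable U) (α : ℝ)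
    (n : ℕ) : Measurable[G n] fun ω => ∑ i ∈ Finset.range n, weight U α X p i ω := by
  refine @Finset.measurable_fun_sum _ _ _ _ _ _ (G n) _ _ fun i hi => ?_
  exact (hs.measurable_weight hU α i).mono (hs.le_of_le (by simp at hi; omega)) le_rfl

lemma measurable_sum_weight_smul (hs : IsSequentialSampling 𝒬 μ G X p) (hU : Measurable U)
    {r : E d → E q} (hr : Measurable r) (α : ℝ) (n : ℕ) :
    Measurable[G n] fun ω => ∑ i ∈ Finset.range n, weight U α X p i ω • r (X (i + 1) ω) := by
  refine @Finset.measurable_fun_sum _ _ _ _ _ _ (G n) _ _ fun i hi => ?_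
  have hle : G (i + 1) ≤ G n := hs.le_of_le (by simp at hi; omega)
  exact Measurable.smul ((hs.measurable_weight hU α i).mono hle le_rfl)
    ((hr.comp (hs.adapted i)).mono hle le_rfl)

lemma lintegral_exp_sum_weight_le (hs : IsSequentialSampling 𝒬 μ G X p) [IsProbabilityMeasure μ]
    (h𝒬 : ∀ p ∈ 𝒬, IsPolicy g₀ φ M p) (h : IsLaplacePotential U x₀ H) (hg : ∀ x, 0 < g₀ x)
    (hc : ∀ x, Real.exp (-U x) ≤ c₀ * g₀ x) (hc0 : 0 < c₀) {α : ℝ} (hα : 1 ≤ α) {s : ℝ}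
    (hs0 : 0 ≤ s) (n : ℕ) :
    ∫⁻ ω, ENNReal.ofReal (Real.exp (-s * ∑ i ∈ Finset.range n, weight U α X p i ω)) ∂μ ≤
      ENNReal.ofReal (Real.exp (-(s - s ^ 2 * c₀ / 2) * partition U α)) ^ n := by
  induction n with
  | zero => simp
  | succ n ih =>
    have h1 := @HasCondDensity.lintegral_exp_step d q U x₀ H φ g₀ c₀ M Ω Ω mΩ (G n) μ id _ _
      (hs.cond_density n) (hs.density_measurable n) ((hs.density_mem n).mono fun ω hω => h𝒬 _ hω)
      h hg hc hc0 α hα s hs0 _ (hs.measurable_sum_weight h.measurable α n)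
      (measurable_id'' (hs.le n))
    simp only [Finset.sum_range_succ]
    refine h1.trans ?_
    rw [pow_succ]
    exact mul_le_mul' ih le_rfl

lemma lintegral_norm_sum_weight_smul_sq_le (hs : IsSequentialSampling 𝒬 μ G X p)
    [IsProbabilityMeasure μ]
    (h𝒬 : ∀ p ∈ 𝒬, IsPolicy g₀ φ M p) (h : IsLaplacePotential U x₀ H) (hφ : Measurable φ)
    (hφ2 : Integrable fun x => Real.exp (-U x) * ‖φ x‖ ^ 2) (hg : ∀ x, 0 < g₀ x)
    (hgm : Measurable g₀)
    (hc : ∀ x, Real.exp (-U x) ≤ c₀ * g₀ x) {α : ℝ} (hα : 1 ≤ α) (n : ℕ) :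
    ∫⁻ ω, ENNReal.ofReal (‖∑ i ∈ Finset.range n,
      weight U α X p i ω • (φ (X (i + 1) ω) - gibbsMean U φ α)‖ ^ 2) ∂μ ≤
      n * ENNReal.ofReal (varBound U φ g₀ α) := by
  induction n with
  | zero => simp
  | succ n ih =>
    have h1 := @HasCondDensity.lintegral_norm_sq_step d q U x₀ H φ g₀ c₀ M Ω Ω mΩ (G n) μ _ id _ _
      (hs.cond_density n) (hs.density_measurable n) ((hs.density_mem n).mono fun ω hω => h𝒬 _ hω)
      h hφ hφ2 hg hgm hc α hα _ (hs.measurable_sum_weight_smul h.measurable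
        (r := fun x => φ x - gibbsMean U φ α) (by fun_prop) α n)
    simp only [Finset.sum_range_succ]
    refine h1.trans ?_
    push_cast
    rw [add_mul, one_mul]
    gcongr
    exact ih

lemma lintegral_norm_pow_four_le (hs : IsSequentialSampling 𝒬 μ G X p) [IsProbabilityMeasure μ]
    (h𝒬 : ∀ p ∈ 𝒬, IsPolicy g₀ φ M p) (hφ : Measurable φ) (i : ℕ) :
    ∫⁻ ω, ENNReal.ofReal (‖φ (X (i + 1) ω)‖ ^ 4) ∂μ ≤ ENNReal.ofReal M := by
  have hm : @Measurable (Ω × E d) ℝ≥0∞ ((G i).prod inferInstance) _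
      fun z => ENNReal.ofReal (‖φ z.2‖ ^ 4) :=
    (by fun_prop : Measurable fun x => ENNReal.ofReal (‖φ x‖ ^ 4)).comp
      (@measurable_snd Ω (E d) (G i) _)
  have h1 := hs.cond_density i _ hm
  simp only at h1
  rw [h1]
  calc _ ≤ ∫⁻ _ω, ENNReal.ofReal M ∂μ := by
        refine lintegral_mono_ae ((hs.density_mem i).mono fun ω hω => ?_)
        have hp := h𝒬 _ hω
        exact (lintegral_ofReal_mul_ofReal_le hp.isProbDensity.2.1 (fun x => by positivity)
          hp.integrable fun x => le_rfl).trans (ENNReal.ofReal_le_ofReal hp.integral_le)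
    _ = _ := by simp

end IsSequentialSampling

end Sampling

lemma norm_inv_smul_sum_le {ι V : Type*} [SeminormedAddCommGroup V] [NormedSpace ℝ V]
    {s : Finset ι} {w : ι → ℝ} {v : ι → V} {R : ℝ} (hw : ∀ i ∈ s, 0 ≤ w i)
    (hS : 0 < ∑ i ∈ s, w i) (hv : ∀ i ∈ s, ‖v i‖ ≤ R) :
    ‖(∑ i ∈ s, w i)⁻¹ • ∑ i ∈ s, w i • v i‖ ≤ R := by
  rw [norm_smul, Real.norm_of_nonneg (by positivity), inv_mul_le_iff₀ hS, Finset.sum_mul]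
  refine (norm_sum_le _ _).trans (Finset.sum_le_sum fun i hi => ?_)
  rw [norm_smul, Real.norm_of_nonneg (hw i hi)]
  exact mul_le_mul_of_nonneg_left (hv i hi) (hw i hi)

/-- The fourth power of the norm of a convex combination is at most the sum of the fourth powers
of the norms. -/
lemma norm_inv_smul_sum_pow_four_le {ι V : Type*} [SeminormedAddCommGroup V] [NormedSpace ℝ V]
    {s : Finset ι} {w : ι → ℝ} {v : ι → V} (hw : ∀ i ∈ s, 0 ≤ w i) (hS : 0 < ∑ i ∈ s, w i) :
    ‖(∑ i ∈ s, w i)⁻¹ • ∑ i ∈ s, w i • v i‖ ^ 4 ≤ ∑ i ∈ s, ‖v i‖ ^ 4 := by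
  set Q := ∑ i ∈ s, ‖v i‖ ^ 4
  have hQ : 0 ≤ Q := Finset.sum_nonneg fun i _ => by positivity
  have hR : √(√Q) ^ 4 = Q := by
    rw [show 4 = 2 * 2 from rfl, pow_mul, Real.sq_sqrt (Real.sqrt_nonneg _), Real.sq_sqrt hQ]
  have h1 : ∀ i ∈ s, ‖v i‖ ≤ √(√Q) := fun i hi => by
    refine le_of_pow_le_pow_left₀ (n := 4) (by norm_num) (Real.sqrt_nonneg _) ?_
    rw [hR]
    exact Finset.single_le_sum (f := fun i => ‖v i‖ ^ 4) (fun i _ => by positivity) hi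
  calc _ ≤ √(√Q) ^ 4 := by
        gcongr
        exact norm_inv_smul_sum_le hw hS h1
    _ = Q := hR

section Sampling

variable {d q : ℕ} {U : E d → ℝ} {x₀ : E d} {H : Matrix (Fin d) (Fin d) ℝ}
  {φ : E d → E q} {g₀ : E d → ℝ} {c₀ M : ℝ} {𝒬 : Set (E d → ℝ)} {Ω : Type*}
  {mΩ : MeasurableSpace Ω} {μ : Measure Ω} {G : ℕ → MeasurableSpace Ω} {X : ℕ → Ω → E d}
  {p : ℕ → Ω → E d → ℝ}

namespace IsSequentialSampling

/-- Lower tail bound for the sum of the weights. -/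
lemma measure_sum_weight_le (hs : IsSequentialSampling 𝒬 μ G X p) [IsProbabilityMeasure μ]
    (h𝒬 : ∀ p ∈ 𝒬, IsPolicy g₀ φ M p) (h : IsLaplacePotential U x₀ H) (hg : ∀ x, 0 < g₀ x)
    (hc : ∀ x, Real.exp (-U x) ≤ c₀ * g₀ x) (hc0 : 0 < c₀) {α : ℝ} (hα : 1 ≤ α) (n : ℕ) :
    μ {ω | ∑ i ∈ Finset.range n, weight U α X p i ω ≤ 2 / 3 * (n * partition U α)} ≤
      ENNReal.ofReal (Real.exp (-(n * partition U α / (18 * c₀)))) := by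
  set Z := partition U α
  set s := 1 / (3 * c₀) with hsdef
  have hs0 : 0 ≤ s := by positivity
  have hS := (hs.measurable_sum_weight h.measurable α n).mono (hs.le n) le_rfl
  have hB : MeasurableSet
      {ω | ∑ i ∈ Finset.range n, weight U α X p i ω ≤ 2 / 3 * (n * Z)} :=
    measurableSet_le hS measurable_const
  rw [← lintegral_indicator_one hB]
  calc _ ≤ ∫⁻ ω, ENNReal.ofReal (Real.exp (s * (2 / 3 * (n * Z)))) *
      ENNReal.ofReal (Real.exp (-s * ∑ i ∈ Finset.range n, weight U α X p i ω)) ∂μ := by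
        refine lintegral_mono fun ω => ?_
        refine Set.indicator_apply_le' (fun hω => ?_) (fun _ => by simp)
        rw [← ENNReal.ofReal_mul (Real.exp_nonneg _), ← Real.exp_add, Pi.one_apply,
          ← ENNReal.ofReal_one]
        refine ENNReal.ofReal_le_ofReal (Real.one_le_exp ?_)
        have := mul_le_mul_of_nonneg_left (Set.mem_ofPred_eq ▸ hω) hs0
        linarith
    _ ≤ ENNReal.ofReal (Real.exp (s * (2 / 3 * (n * Z)))) *
        ENNReal.ofReal (Real.exp (-(s - s ^ 2 * c₀ / 2) * Z)) ^ n := by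
        rw [lintegral_const_mul' _ _ ENNReal.ofReal_ne_top]
        gcongr
        exact hs.lintegral_exp_sum_weight_le h𝒬 h hg hc hc0 hα hs0 n
    _ = _ := by
        rw [← ENNReal.ofReal_pow (Real.exp_nonneg _), ← ENNReal.ofReal_mul (Real.exp_nonneg _),
          ← Real.exp_nat_mul, ← Real.exp_add]
        congr 2
        rw [hsdef]
        field_simp
        ring

lemma measurable_estimator (hs : IsSequentialSampling 𝒬 μ G X p) (hU : Measurable U)
    (hφ : Measurable φ) (α : ℝ) (n : ℕ) : Measurable (estimator U φ α X p n) :=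
  Measurable.smul ((hs.measurable_sum_weight hU α n).mono (hs.le n) le_rfl).inv
    ((hs.measurable_sum_weight_smul hU hφ α n).mono (hs.le n) le_rfl)

lemma ae_weight_pos (hs : IsSequentialSampling 𝒬 μ G X p) (h𝒬 : ∀ p ∈ 𝒬, IsPolicy g₀ φ M p)
    (hg : ∀ x, 0 < g₀ x) (α : ℝ) : ∀ᵐ ω ∂μ, ∀ i, 0 < weight U α X p i ω := by
  rw [ae_all_iff]
  exact fun i => (hs.density_mem i).mono fun ω hω =>
    div_pos (Real.exp_pos _) ((hg _).trans_le ((h𝒬 _ hω).le _))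

/-- Pointwise error bound, according to whether the sum of the weights is small or not. -/
lemma norm_estimator_sub_sq_le {α : ℝ} {n : ℕ} (hn : 1 ≤ n) {ω : Ω}
    (hw : ∀ i, 0 < weight U α X p i ω) {Z : ℝ} (hZ : 0 < Z) {s : ℝ} (hs : 0 < s) {K : ℝ} {a : E q}
    (hK : ‖a‖ ^ 2 ≤ K) :
    ‖estimator U φ α X p n ω - a‖ ^ 2 ≤
      {ω | ∑ i ∈ Finset.range n, weight U α X p i ω ≤ 2 / 3 * (n * Z)}.indicator
        (fun _ => s + 2 * K) ω +
      (1 / s * (∑ i ∈ Finset.range n, ‖φ (X (i + 1) ω)‖ ^ 4) + 9 / 4 / (n * Z) ^ 2 *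
        ‖∑ i ∈ Finset.range n, weight U α X p i ω • (φ (X (i + 1) ω) - a)‖ ^ 2) := by
  have hS : 0 < ∑ i ∈ Finset.range n, weight U α X p i ω :=
    Finset.sum_pos (fun i _ => hw i) (by simp; omega)
  have hn0 : (0 : ℝ) < n := by exact_mod_cast hn
  have h4 : ‖estimator U φ α X p n ω‖ ^ 4 ≤ ∑ i ∈ Finset.range n, ‖φ (X (i + 1) ω)‖ ^ 4 :=
    norm_inv_smul_sum_pow_four_le (fun i _ => (hw i).le) hS
  have hdiff : estimator U φ α X p n ω - a = (∑ i ∈ Finset.range n, weight U α X p i ω)⁻¹ •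
      ∑ i ∈ Finset.range n, weight U α X p i ω • (φ (X (i + 1) ω) - a) := by
    simp only [smul_sub, Finset.sum_sub_distrib, ← Finset.sum_smul]
    rw [smul_smul, inv_mul_cancel₀ hS.ne', one_smul, estimator]
  set Q := ∑ i ∈ Finset.range n, ‖φ (X (i + 1) ω)‖ ^ 4
  have hQ : 0 ≤ Q := (by positivity : (0 : ℝ) ≤ ‖estimator U φ α X p n ω‖ ^ 4).trans h4
  set T := ∑ i ∈ Finset.range n, weight U α X p i ω • (φ (X (i + 1) ω) - a)
  by_cases hB : ∑ i ∈ Finset.range n, weight U α X p i ω ≤ 2 / 3 * (n * Z)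
  · rw [Set.indicator_of_mem (by exact hB)]
    have h1 := norm_sub_sq_le_two (estimator U φ α X p n ω) a
    set e := ‖estimator U φ α X p n ω‖
    have h2 : 2 * e ^ 2 ≤ s + 1 / s * Q := by
      have : 2 * e ^ 2 ≤ s + 1 / s * e ^ 4 := by
        have h3 : s + 1 / s * e ^ 4 - 2 * e ^ 2 = (s - e ^ 2) ^ 2 / s := by field_simp; ring
        have h5 : 0 ≤ (s - e ^ 2) ^ 2 / s := by positivity
        linarith
      refine this.trans ?_
      gcongr
    have h3 : 0 ≤ 9 / 4 / (n * Z) ^ 2 * ‖T‖ ^ 2 := by positivity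
    linarith
  · rw [Set.indicator_of_notMem (by exact hB), hdiff, norm_smul, mul_pow,
      Real.norm_of_nonneg (by positivity), inv_pow]
    have h3 : 0 ≤ 1 / s * Q := by positivity
    have h5 : ((∑ i ∈ Finset.range n, weight U α X p i ω) ^ 2)⁻¹ ≤ 9 / 4 / (n * Z) ^ 2 := by
      push Not at hB
      calc _ ≤ ((2 / 3 * (n * Z)) ^ 2)⁻¹ := by gcongr
        _ = _ := by field_simp; norm_num
    have h6 := mul_le_mul_of_nonneg_right h5 (by positivity : 0 ≤ ‖T‖ ^ 2)
    linarith

/-- Mean squared error bound with a free parameter `s`. -/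
lemma integrable_and_integral_le (hs : IsSequentialSampling 𝒬 μ G X p) [IsProbabilityMeasure μ]
    (h𝒬 : ∀ p ∈ 𝒬, IsPolicy g₀ φ M p) (hM : 0 ≤ M) (h : IsLaplacePotential U x₀ H)
    (hφ : Measurable φ)
    (hφ2 : Integrable fun x => Real.exp (-U x) * ‖φ x‖ ^ 2) (hg : ∀ x, 0 < g₀ x)
    (hgm : Measurable g₀) (hc : ∀ x, Real.exp (-U x) ≤ c₀ * g₀ x) (hc0 : 0 < c₀)
    {α : ℝ} (hα : 1 ≤ α) {n : ℕ} (hn : 1 ≤ n) {s : ℝ} (hs0 : 0 < s) {K : ℝ}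
    (hK : ‖gibbsMean U φ α‖ ^ 2 ≤ K) :
    Integrable (fun ω => ‖estimator U φ α X p n ω - gibbsMean U φ α‖ ^ 2) μ ∧
    ∫ ω, ‖estimator U φ α X p n ω - gibbsMean U φ α‖ ^ 2 ∂μ ≤
      (s + 2 * K) * Real.exp (-(n * partition U α / (18 * c₀))) + n * M / s +
        9 / 4 * (n : ℝ)⁻¹ * (varBound U φ g₀ α / partition U α ^ 2) := by
  have hZ := h.partition_pos hα
  have hA := IsLaplacePotential.varBound_nonneg (U := U) (φ := φ) hg α
  have hn0 : (0 : ℝ) < n := by exact_mod_cast hn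
  have hK0 : 0 ≤ K := (by positivity : 0 ≤ ‖gibbsMean U φ α‖ ^ 2).trans hK
  have htail := hs.measure_sum_weight_le h𝒬 h hg hc hc0 hα n
  have hvar := hs.lintegral_norm_sum_weight_smul_sq_le h𝒬 h hφ hφ2 hg hgm hc hα n
  have hS := (hs.measurable_sum_weight h.measurable α n).mono (hs.le n) le_rfl
  have hT := (hs.measurable_sum_weight_smul h.measurable
    (r := fun x => φ x - gibbsMean U φ α) (by fun_prop) α n).mono (hs.le n) le_rfl
  have hX : ∀ i, Measurable (X (i + 1)) := fun i => (hs.adapted i).mono (hs.le _) le_rfl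
  have hest := hs.measurable_estimator h.measurable hφ α n
  set Z := partition U α
  set a := gibbsMean U φ α
  set A := varBound U φ g₀ α
  set B := {ω | ∑ i ∈ Finset.range n, weight U α X p i ω ≤ 2 / 3 * (n * Z)} with hBdef
  have hB : MeasurableSet B := measurableSet_le hS measurable_const
  set b := Real.exp (-(n * Z / (18 * c₀)))
  set R := (s + 2 * K) * b + n * M / s + 9 / 4 * (n : ℝ)⁻¹ * (A / Z ^ 2) with hR
  have hR0 : 0 ≤ R := by positivity
  have hlint : ∫⁻ ω, ENNReal.ofReal (‖estimator U φ α X p n ω - a‖ ^ 2) ∂μ ≤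
      ENNReal.ofReal R := by
    calc _ ≤ ∫⁻ ω, (B.indicator (fun _ => ENNReal.ofReal (s + 2 * K)) ω +
          (ENNReal.ofReal (1 / s) * (∑ i ∈ Finset.range n, ENNReal.ofReal (‖φ (X (i + 1) ω)‖ ^ 4)) +
          ENNReal.ofReal (9 / 4 / (n * Z) ^ 2) * ENNReal.ofReal (‖∑ i ∈ Finset.range n,
            weight U α X p i ω • (φ (X (i + 1) ω) - a)‖ ^ 2))) ∂μ := by
          refine lintegral_mono_ae ((hs.ae_weight_pos (U := U) h𝒬 hg α).mono fun ω hω => ?_)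
          refine (ENNReal.ofReal_le_ofReal
            (norm_estimator_sub_sq_le hn hω hZ hs0 hK)).trans ?_
          refine ENNReal.ofReal_add_le.trans (add_le_add ?_ ?_)
          · rw [← hBdef]
            by_cases hωB : ω ∈ B <;> simp [hωB]
          · refine ENNReal.ofReal_add_le.trans (add_le_add ?_ ?_)
            · rw [ENNReal.ofReal_mul (by positivity),
                ENNReal.ofReal_sum_of_nonneg fun i _ => by positivity]
            · rw [ENNReal.ofReal_mul (by positivity)]
      _ ≤ ENNReal.ofReal (s + 2 * K) * ENNReal.ofReal b +
          (ENNReal.ofReal (1 / s) * (n * ENNReal.ofReal M) +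
          ENNReal.ofReal (9 / 4 / (n * Z) ^ 2) * (n * ENNReal.ofReal A)) := by
          rw [lintegral_add_left (measurable_const.indicator hB),
            lintegral_add_left (by fun_prop), lintegral_indicator_const hB,
            lintegral_const_mul' _ _ ENNReal.ofReal_ne_top,
            lintegral_const_mul' _ _ ENNReal.ofReal_ne_top,
            lintegral_finsetSum _ fun i _ => by fun_prop]
          gcongr
          refine (Finset.sum_le_sum fun i _ => hs.lintegral_norm_pow_four_le h𝒬 hφ i).trans ?_
          simp
      _ = ENNReal.ofReal R := by
          have hnn : (n : ℝ≥0∞) = ENNReal.ofReal n := by simp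
          rw [hnn, ← ENNReal.ofReal_mul hn0.le, ← ENNReal.ofReal_mul hn0.le,
            ← ENNReal.ofReal_mul (by positivity), ← ENNReal.ofReal_mul (by positivity),
            ← ENNReal.ofReal_mul (by positivity), ← ENNReal.ofReal_add (by positivity)
            (by positivity), ← ENNReal.ofReal_add (by positivity) (by positivity), hR]
          congr 1
          field_simp
          ring
  have hm : AEStronglyMeasurable (fun ω => ‖estimator U φ α X p n ω - a‖ ^ 2) μ :=
    Measurable.aestronglyMeasurable (by fun_prop)
  have hnn : 0 ≤ᵐ[μ] fun ω => ‖estimator U φ α X p n ω - a‖ ^ 2 :=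
    Eventually.of_forall fun ω => by positivity
  refine ⟨(lintegral_ofReal_ne_top_iff_integrable hm hnn).1
    (ne_top_of_le_ne_top ENNReal.ofReal_ne_top hlint), ?_⟩
  rw [integral_eq_lintegral_of_nonneg_ae hnn hm]
  exact ENNReal.toReal_le_of_le_ofReal hR0 hlint

end IsSequentialSampling

end Sampling

section Shift

variable {d q : ℕ} {Ω : Type*}

lemma exp_neg_mul_eq_exp_mul_exp (f : E d → ℝ) (x₀ : E d) (α : ℝ) (x : E d) :
    Real.exp (-α * f x) = Real.exp (-α * f x₀) * Real.exp (-α * (f x - f x₀)) := by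
  rw [← Real.exp_add]; congr 1; ring

lemma estimator_sub_const (f : E d → ℝ) (x₀ : E d) (φ : E d → E q) (α : ℝ) (X : ℕ → Ω → E d)
    (p : ℕ → Ω → E d → ℝ) (n : ℕ) (ω : Ω) :
    estimator f φ α X p n ω = estimator (fun x => f x - f x₀) φ α X p n ω := by
  have hw : ∀ i, weight f α X p i ω =
      Real.exp (-α * f x₀) * weight (fun x => f x - f x₀) α X p i ω := fun i => by
    rw [weight, weight, exp_neg_mul_eq_exp_mul_exp f x₀, mul_div_assoc]
  simp only [estimator, hw, mul_smul, ← Finset.mul_sum, ← Finset.smul_sum]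
  rw [mul_inv, smul_smul, mul_right_comm, inv_mul_cancel₀ (Real.exp_pos _).ne', one_mul]

lemma integral_gibbs {f : E d → ℝ} (hf : Measurable f) (x₀ : E d) (φ : E d → E q) (α : ℝ) :
    ∫ x, φ x ∂(gibbs f α) = gibbsMean (fun x => f x - f x₀) φ α := by
  have hZ : Zc f α = Real.exp (-α * f x₀) * partition (fun x => f x - f x₀) α := by
    rw [Zc, partition, ← integral_const_mul]
    exact integral_congr_ae (Eventually.of_forall fun x => exp_neg_mul_eq_exp_mul_exp f x₀ α x)
  have hZ0 : 0 ≤ Zc f α := integral_nonneg fun x => Real.exp_nonneg _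
  rw [gibbs, integral_withDensity_eq_integral_toReal_smul (by fun_prop)
    (Eventually.of_forall fun x => ENNReal.ofReal_lt_top), gibbsMean, ← integral_smul]
  refine integral_congr_ae (Eventually.of_forall fun x => ?_)
  simp only
  rw [ENNReal.toReal_ofReal (div_nonneg (Real.exp_nonneg _) hZ0), hZ,
    exp_neg_mul_eq_exp_mul_exp f x₀, mul_div_mul_left _ _ (Real.exp_pos _).ne', smul_smul,
    div_eq_inv_mul]

end Shift

lemma mconst_eq {d : ℕ} {f : E d → ℝ} {x : E d} (hH : (hess f x).PosDef) {α : ℝ} (hα : 0 ≤ α) :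
    mconst f x α = α ^ ((d : ℝ) / 2) / gaussConst (hess f x) := by
  rw [mconst, gaussConst_eq hH, Real.div_rpow hα (by positivity)]
  have := Real.sqrt_pos.2 hH.det_pos
  field_simp

/-- At a zero of a nonnegative function the Laplace constant is a trace. -/
lemma laplaceConst_of_nonneg {d : ℕ} {f ψ : E d → ℝ} {x : E d} (hψ : ∀ y, 0 ≤ ψ y) (h0 : ψ x = 0) :
    fderiv ℝ ψ x = 0 ∧ laplaceConst f x ψ = |((hess f x)⁻¹ * hess ψ x).trace| := by
  have hd : fderiv ℝ ψ x = 0 :=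
    IsLocalMin.fderiv_eq_zero (Eventually.of_forall fun y => by rw [h0]; exact hψ y)
  refine ⟨hd, ?_⟩
  have : grad ψ x = 0 := by ext i; simp [grad, hd]
  simp [laplaceConst, this]

lemma IsLaplacePotential.trace_nonneg {d : ℕ} {U ψ : E d → ℝ} {x₀ : E d}
    {H B : Matrix (Fin d) (Fin d) ℝ} (h : IsLaplacePotential U x₀ H) (hψm : Measurable ψ)
    (hψ0 : ∀ x, 0 ≤ ψ x)
    (hψ : (fun x => ψ x - qform B (x - x₀) / 2) =o[𝓝 x₀] fun x => ‖x - x₀‖ ^ 2)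
    {t₀ : ℝ} (hint : Integrable fun x => Real.exp (-t₀ * U x) * ψ x) :
    0 ≤ (H⁻¹ * B).trace := by
  have hlim := h.tendsto_of_isLittleO hψm B 1 (by simpa using hψ) hint
  have hG := gaussConst_pos h.posDef
  have h1 : 0 ≤ 1 * ((H⁻¹ * B).trace / 2) * gaussConst H := by
    refine ge_of_tendsto hlim ?_
    filter_upwards [eventually_ge_atTop 0] with t ht
    exact mul_nonneg (by positivity)
      (integral_nonneg fun x => mul_nonneg (Real.exp_nonneg _) (hψ0 x))
  have := nonneg_of_mul_nonneg_left h1 hG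
  linarith

/-- The sample size condition makes the probability of the bad event negligible. -/
lemma exp_neg_le_of_sample_size {n k c₀ a Z L : ℝ} (hn : 0 ≤ n) (hk : 0 < k) (hc0 : 0 < c₀)
    (ha : 0 < a) (hkZ : k ≤ a * Z) (hL : 0 < L)
    (hnL : n ≥ 36 * c₀ / k * a * Real.log L) :
    Real.exp (-(n * Z / (18 * c₀))) ≤ (L ^ 2)⁻¹ := by
  rw [← Real.exp_log hL, ← Real.exp_nat_mul, ← Real.exp_neg, Real.exp_le_exp]
  have hZ : k / a ≤ Z := by rw [div_le_iff₀ ha, mul_comm]; exact hkZ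
  push_cast
  rw [neg_le_neg_iff, le_div_iff₀ (by positivity)]
  calc 2 * Real.log L * (18 * c₀) = 36 * c₀ / k * a * Real.log L * (k / a) := by
        field_simp; ring
    _ ≤ n * (k / a) := by gcongr
    _ ≤ n * Z := by gcongr

/-- Contribution of the bad event, for the choice `s = √n L` of the free parameter. -/
lemma bad_event_bound {n b L K M D : ℝ} (hn : 1 ≤ n) (hL : 0 < L) (hb : 0 ≤ b) (hb1 : b ≤ 1)
    (hbL : b ≤ (L ^ 2)⁻¹) (hK : 0 ≤ K) (hM : 0 ≤ M) (hD : √n / L ≤ D) :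
    (√n * L + 2 * K) * b + n * M / (√n * L) ≤ (1 + 2 * K + M) * D := by
  have hsn : 1 ≤ √n := Real.one_le_sqrt.2 hn
  have hb2 : b ≤ L⁻¹ := by
    refine le_of_sq_le_sq ?_ (by positivity)
    rw [inv_pow]
    nlinarith
  have h1 : √n * L * b ≤ √n / L := by
    calc _ ≤ √n * L * (L ^ 2)⁻¹ := by gcongr
      _ = _ := by field_simp
  have h2 : 2 * K * b ≤ 2 * K * (√n / L) := by
    have : b ≤ √n / L := by
      rw [div_eq_mul_inv]
      exact hb2.trans (le_mul_of_one_le_left (by positivity) hsn)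
    gcongr
  have h3 : n * M / (√n * L) = M * (√n / L) := by
    have : n = √n * √n := (Real.mul_self_sqrt (by linarith)).symm
    rw [div_eq_iff (by positivity)]
    conv_lhs => rw [this]
    field_simp
  calc _ ≤ (1 + 2 * K + M) * (√n / L) := by rw [h3]; linarith
    _ ≤ _ := by gcongr

end LISO

theorem stmt15 {d q : ℕ} (hd : 1 ≤ d)
    (f : E d → ℝ) (xs : E d)
    (hf : ContDiff ℝ 4 f)
    (hmin : ∀ x, x ≠ xs → f xs < f x)
    (hsep : ∀ δ > (0 : ℝ), ∃ η > (0 : ℝ), ∀ x, δ ≤ ‖x - xs‖ → f xs + η ≤ f x)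
    (hpd : (hess f xs).PosDef)
    (hfint : Integrable fun x => Real.exp (-f x))
    (φ : E d → E q) (hφ : Measurable φ)
    (hφ2 : Integrable fun y => Real.exp (-(f y - f xs)) * ‖φ y‖ ^ 2) :
    ∃ αt > (1 : ℝ), ∀ g₀ : E d → ℝ, (∀ x, 0 < g₀ x) →
      (∃ c₀ > (0 : ℝ), ∀ y, Real.exp (-(f y - f xs)) ≤ c₀ * g₀ y) →
      (ContDiff ℝ 2 fun x => ‖φ x‖ ^ 2 / g₀ x) →
      (ContDiff ℝ 2 fun x => ‖φ x - φ xs‖ ^ 2 / g₀ x) →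
      (ContDiff ℝ 2 fun x => 1 / g₀ x) →
      (0 < laplaceConst f xs fun x => ‖φ x‖ ^ 2 / g₀ x) →
      (0 < laplaceConst f xs fun x => ‖φ x - φ xs‖ ^ 2 / g₀ x) →
      (0 < laplaceConst f xs fun x => 1 / g₀ x) →
      ∃ c > (0 : ℝ), ∀ M : ℝ, ∃ C > (0 : ℝ), ∀ 𝒬 : Set (E d → ℝ),
        (∀ p ∈ 𝒬, IsProbDensity p ∧ (∀ x, g₀ x ≤ p x) ∧
          (Integrable fun y => ‖φ y‖ ^ 4 * p y) ∧ ∫ y, ‖φ y‖ ^ 4 * p y ≤ M) →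
        ∀ (Ω : Type*) (mΩ : MeasurableSpace Ω) (μ : Measure Ω) [IsProbabilityMeasure μ]
          (F : Filtration ℕ mΩ) (X : ℕ → Ω → E d) (p : ℕ → Ω → E d → ℝ),
          IsAdaptiveSampling 𝒬 μ F X p →
          ∀ α > αt, ∀ n : ℕ, 1 ≤ n →
            (n : ℝ) ≥ c * α ^ ((d : ℝ) / 2) *
                Real.log ((n : ℝ) * α ^ (-(d : ℝ) / 2 + 1) *
                  (Real.sqrt (n : ℝ) + α ^ ((d : ℝ) / 4)) * α) →
            Integrable (fun ω => ‖estimator f φ α X p n ω - ∫ x, φ x ∂(gibbs f α)‖ ^ 2) μ ∧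
            ∫ ω, ‖estimator f φ α X p n ω - ∫ x, φ x ∂(gibbs f α)‖ ^ 2 ∂μ ≤
              9 * (n : ℝ)⁻¹ * mconst f xs α * (2 : ℝ) ^ (-(d : ℝ) / 2) *
                (laplaceConst f xs (fun x => ‖φ x - φ xs‖ ^ 2 / g₀ x) / (2 * α)) *
                (1 + C / α) := by
  have hge : ∀ x, f xs ≤ f x := fun x => by
    by_cases hx : x = xs
    · rw [hx]
    · exact (hmin x hx).le
  have hfm : Measurable f := hf.continuous.measurable
  have hU : IsLaplacePotential (fun x => f x - f xs) xs (hess f xs) :=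
    { posDef := hpd
      measurable := hfm.sub_const _
      nonneg := fun x => sub_nonneg.2 (hge x)
      isLittleO := isLittleO_sub_qform_hess (hf.of_le (by norm_num))
        (IsLocalMin.fderiv_eq_zero (Eventually.of_forall hge))
      separated := fun δ hδ => by
        obtain ⟨η, hη, h⟩ := hsep δ hδ
        exact ⟨η, hη, fun x hx => by linarith [h x hx]⟩
      integrable := by
        refine (hfint.const_mul (Real.exp (f xs))).congr (Eventually.of_forall fun x => ?_)
        simp only [← Real.exp_add]
        congr 1; ring }
  obtain ⟨k, hk, hkZ⟩ := hU.exists_le_partition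
  refine ⟨2, by norm_num, fun g₀ hg ⟨c₀, hc0, hc⟩ _ hψC hgC _ hψpos _ => ?_⟩
  have hgcont : Continuous g₀ := by
    refine (hgC.continuous.inv₀ fun x => one_div_ne_zero (hg x).ne').congr fun x => ?_
    simp
  have hgm := hgcont.measurable
  have hψnn : ∀ x, 0 ≤ ‖φ x - φ xs‖ ^ 2 / g₀ x := fun x => div_nonneg (by positivity) (hg x).le
  obtain ⟨hψd, hψL⟩ := laplaceConst_of_nonneg (f := f) (x := xs) hψnn (by simp)
  have hψo := isLittleO_sub_qform_hess hψC hψd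
  simp only [sub_self, norm_zero, ne_eq, OfNat.ofNat_ne_zero, not_false_eq_true, zero_pow,
    zero_div, sub_zero] at hψo
  rw [hψL] at hψpos ⊢
  set B := hess (fun x => ‖φ x - φ xs‖ ^ 2 / g₀ x) xs
  have hTnn : 0 ≤ ((hess f xs)⁻¹ * B).trace :=
    hU.trace_nonneg (by fun_prop) hψnn hψo (t₀ := 2)
      (hU.integrable_exp_mul_div hg hgm hc (fun x => by positivity) (by fun_prop) (s := 1)
        (by norm_num) (hU.integrable_exp_mul_norm_sub_sq hφ hφ2 _ le_rfl))
  rw [abs_of_nonneg hTnn] at hψpos ⊢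
  set T := ((hess f xs)⁻¹ * B).trace with hT
  obtain ⟨K, hK, hKm⟩ := hU.exists_norm_gibbsMean_sq_le hφ hφ2 hg hgcont.continuousAt hψo
  obtain ⟨C₁, hC₁, hvar⟩ :=
    hU.exists_varBound_le hφ hφ2 hg hgm hgcont.continuousAt hc0 hc hψpos hψo
  have hG := gaussConst_pos hpd
  set G := gaussConst (hess f xs) with hGdef
  refine ⟨36 * c₀ / k, by positivity, fun M => ?_⟩
  set e := (2 : ℝ) ^ (-(d : ℝ) / 2) with he
  have he0 : 0 < e := by positivity
  refine ⟨C₁ + (1 + 2 * K + |M|) * (2 * G / (9 * e * T)), by positivity, ?_⟩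
  intro 𝒬 h𝒬 Ω mΩ μ _ F X p hF α hα n hn hnL
  have h𝒬' : ∀ p ∈ 𝒬, IsPolicy g₀ φ |M| p := fun p hp =>
    ⟨(h𝒬 p hp).1, (h𝒬 p hp).2.1, (h𝒬 p hp).2.2.1, (h𝒬 p hp).2.2.2.trans (le_abs_self M)⟩
  obtain ⟨𝒢, hs⟩ := hF.exists_isSequentialSampling fun p hp => (h𝒬 p hp).1
  have hα0 : 0 < α := by linarith
  have hα1 : 1 ≤ α := by linarith
  have hn1 : (1 : ℝ) ≤ n := by exact_mod_cast hn
  have hn0 : (0 : ℝ) < n := by linarith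
  simp only [estimator_sub_const f xs, integral_gibbs hfm xs]
  set L := (n : ℝ) * α ^ (-(d : ℝ) / 2 + 1) * (√(n : ℝ) + α ^ ((d : ℝ) / 4)) * α with hL
  have hsn : 0 < √(n : ℝ) := Real.sqrt_pos.2 hn0
  have hL0 : 0 < L := by positivity
  obtain ⟨hint, hle⟩ := hs.integrable_and_integral_le h𝒬' (abs_nonneg M) hU hφ hφ2 hg hgm hc hc0
    hα1 hn (show 0 < √(n : ℝ) * L by positivity) (hKm α hα1)
  refine ⟨hint, hle.trans ?_⟩
  set a := α ^ ((d : ℝ) / 2) with ha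
  have ha0 : 0 < a := by positivity
  have hD : √(n : ℝ) / L ≤ a / (n * α ^ 2) := by
    have hpow : α ^ (-(d : ℝ) / 2 + 1) = a⁻¹ * α := by
      rw [Real.rpow_add hα0, Real.rpow_one, neg_div, Real.rpow_neg hα0.le]
    have hLle : (n : ℝ) * (a⁻¹ * α) * √(n : ℝ) * α ≤ L := by
      rw [hL, hpow]
      gcongr
      exact le_add_of_nonneg_right (by positivity)
    calc √(n : ℝ) / L ≤ √(n : ℝ) / ((n : ℝ) * (a⁻¹ * α) * √(n : ℝ) * α) := by gcongr
      _ = _ := by field_simp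
  have hbad := bad_event_bound hn1 hL0 (Real.exp_nonneg _)
    (Real.exp_le_one_iff.2 (neg_nonpos.2 (by have := hU.partition_pos hα1; positivity)))
    (exp_neg_le_of_sample_size hn0.le hk hc0 ha0 (hkZ α hα1) hL0 hnL) hK.le (abs_nonneg M) hD
  have hv := hvar α hα.le
  rw [← ha, ← hT] at hv
  have hv' := mul_le_mul_of_nonneg_left hv (show 0 ≤ 9 / 4 * (n : ℝ)⁻¹ by positivity)
  refine (add_le_add hbad hv').trans (le_of_eq ?_)
  rw [mconst_eq hpd hα0.le, ← ha, ← hGdef]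
  field_simp
  ring
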